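/- arXiv:2004.10090 — 3 statements merged into one kernel-verified Lean document; each statement's English description precedes it below -/
import Mathlib

section
/- There is an absolute constant c > 0 with the following property (Uniform-Adaptive Sampling). Let P be a set of n distinct points in ℝ^d, let γ, δ, η ∈ (0,1), let P_opt ⊆ P with |P_opt| = (1−γ)n, and let o ∈ ℝ^d be a point such that the distances ‖p−o‖ for p ∈ P are pairwise distinct. Assume t := (1+δ)γn is an integer with t ≤ n, and let Q be the t farthest points of P from o. Let m be an integer with m ≥ c·(1/(δγ))·log(1/η) such that t' := (3/2)(1+δ)γm is an integer with t' ≤ m. Let X_1, …, X_m be independent random variables, each uniformly distributed on P, and let Q' ⊆ {1,…,m} be any set of t' sample indices whose sampled points have the t' largest distances to o among ‖X_1−o‖, …, ‖X_m−o‖ (ties between indices that sample the same point of P may be broken arbitrarily). Then, with probability at least 1−η, the number of indices j ∈ Q' with X_j ∈ P_opt ∩ Q is at least (δ/(3(1+δ)))·t'. -/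
open MeasureTheory

open ProbabilityTheory in
/-- moment generating bound for sums of independent 0/1 variables -/
lemma uas_mgf {Ω : Type*} [MeasurableSpace Ω] (μ : Measure Ω) [IsProbabilityMeasure μ]
    (m : ℕ) (V : Fin m → Ω → ℝ) (hV : ∀ i, Measurable (V i)) (hind : iIndepFun V μ)
    (h01 : ∀ i ω, V i ω = 0 ∨ V i ω = 1) (q : ℝ) (hq : ∀ i, ∫ ω, V i ω ∂μ = q) (t : ℝ) :
    mgf (∑ i, V i) μ t ≤ Real.exp (m * q * (Real.exp t - 1)) := by
  have hVint : ∀ i, Integrable (V i) μ := fun i =>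
    Integrable.of_bound (hV i).aestronglyMeasurable 1
      (Filter.Eventually.of_forall fun ω => by rcases h01 i ω with h | h <;> simp [h])
  rw [iIndepFun.mgf_sum hind hV]
  have h1 : ∀ i, mgf (V i) μ t ≤ Real.exp (q * (Real.exp t - 1)) := by
    intro i
    have : mgf (V i) μ t = 1 + q * (Real.exp t - 1) := by
      unfold mgf
      have e : (fun ω => Real.exp (t * V i ω)) = fun ω => 1 + V i ω * (Real.exp t - 1) := by
        funext ω
        rcases h01 i ω with h | h <;> simp [h]
      rw [e, integral_add (integrable_const _) ((hVint i).mul_const _), integral_mul_const, hq]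
      simp
    rw [this, add_comm]
    exact Real.add_one_le_exp _
  calc ∏ i, mgf (V i) μ t ≤ ∏ i : Fin m, Real.exp (q * (Real.exp t - 1)) :=
        Finset.prod_le_prod (fun i _ => mgf_nonneg) (fun i _ => h1 i)
    _ = _ := by
        rw [Finset.prod_const, ← Real.exp_nat_mul]
        simp [mul_assoc]

open ProbabilityTheory in
/-- second moment bound for sums of independent 0/1 variables -/
lemma uas_sq {Ω : Type*} [MeasurableSpace Ω] (μ : Measure Ω) [IsProbabilityMeasure μ]
    (m : ℕ) (V : Fin m → Ω → ℝ) (hV : ∀ i, Measurable (V i)) (hind : iIndepFun V μ)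
    (h01 : ∀ i ω, V i ω = 0 ∨ V i ω = 1) (q : ℝ) (hq : ∀ i, ∫ ω, V i ω ∂μ = q)
    (S : Finset (Fin m)) (b : ℝ) :
    ∫ ω, (∑ i ∈ S, V i ω - b) ^ 2 ∂μ ≤ S.card * q + (S.card * q - b) ^ 2 := by
  have hL : ∀ i, MemLp (V i) 2 μ := fun i =>
    MemLp.of_bound (hV i).aestronglyMeasurable 1
      (Filter.Eventually.of_forall fun ω => by rcases h01 i ω with h | h <;> simp [h])
  have hVint : ∀ i, Integrable (V i) μ := fun i => (hL i).integrable (by norm_num)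
  have hLs : MemLp (∑ i ∈ S, V i) 2 μ := memLp_finsetSum' S (fun i _ => hL i)
  have hmean : ∫ ω, (∑ i ∈ S, V i) ω ∂μ = S.card * q := by
    simp only [Finset.sum_apply]
    rw [integral_finsetSum _ (fun i _ => hVint i)]
    simp [hq]
  have hvar : variance (∑ i ∈ S, V i) μ ≤ S.card * q := by
    rw [IndepFun.variance_sum (fun i _ => hL i) (fun i _ j _ hij => hind.indepFun hij)]
    calc ∑ i ∈ S, variance (V i) μ ≤ ∑ i ∈ S, q := by
          refine Finset.sum_le_sum fun i _ => ?_
          refine (variance_le_expectation_sq (hV i).aestronglyMeasurable).trans ?_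
          rw [← hq i]
          refine le_of_eq (integral_congr_ae (Filter.Eventually.of_forall fun ω => ?_))
          rcases h01 i ω with h | h <;> simp [h]
      _ = _ := by simp
  rw [variance_eq_sub hLs, hmean] at hvar
  have hi1 : Integrable (fun ω => (∑ i ∈ S, V i) ω ^ 2) μ := hLs.integrable_sq
  have hi2 : Integrable (∑ i ∈ S, V i) μ := hLs.integrable (by norm_num)
  have e : ∫ ω, (∑ i ∈ S, V i ω - b) ^ 2 ∂μ
      = ∫ ω, ((∑ i ∈ S, V i) ω ^ 2 - 2 * b * (∑ i ∈ S, V i) ω + b ^ 2) ∂μ := by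
    refine integral_congr_ae (Filter.Eventually.of_forall fun ω => ?_)
    simp only [Finset.sum_apply]
    ring
  have hi3 : Integrable
      (fun ω => (∑ i ∈ S, V i) ω ^ 2 - 2 * b * (∑ i ∈ S, V i) ω) μ := hi1.sub (hi2.const_mul _)
  rw [e, integral_add hi3 (integrable_const _),
    integral_sub hi1 (hi2.const_mul _), integral_const_mul, hmean]
  have e2 : ∫ ω, (∑ i ∈ S, V i) ω ^ 2 ∂μ = ∫ ω, ((∑ i ∈ S, V i) ^ 2) ω ∂μ := rfl
  rw [e2, integral_const, probReal_univ, one_smul]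
  nlinarith

lemma uas_nat {ι : Type*} (S : Finset ι) (v : ι → ℝ) (h : ∀ i, v i = 0 ∨ v i = 1) :
    ∃ k : ℕ, ∑ i ∈ S, v i = k := by
  classical
  refine ⟨∑ i ∈ S, if v i = 1 then 1 else 0, ?_⟩
  push_cast
  refine Finset.sum_congr rfl fun i _ => ?_
  rcases h i with h | h <;> simp [h]

open ProbabilityTheory in
lemma uas_core {Ω : Type*} [MeasurableSpace Ω] (μ : Measure Ω) [IsProbabilityMeasure μ]
    (m : ℕ) (W : Fin m → Ω → ℝ × ℝ) (hW : ∀ i, Measurable (W i)) (hind : iIndepFun W μ)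
    (h1 : ∀ i ω, (W i ω).1 = 0 ∨ (W i ω).1 = 1) (h2 : ∀ i ω, (W i ω).2 = 0 ∨ (W i ω).2 = 1)
    (h12 : ∀ i ω, (W i ω).1 ≤ (W i ω).2)
    (a q : ℝ) (ha : ∀ i, ∫ ω, (W i ω).1 ∂μ = a) (hq : ∀ i, ∫ ω, (W i ω).2 ∂μ = q)
    (hq1 : q ≤ 1) (hq0 : 0 ≤ q) (ha0 : 0 ≤ a)
    (s : ℕ) (hsq : (s : ℝ) = 3 / 2 * (m * q)) (x : ℝ) (hx : 0 < x) (hxy : x ≤ m * a)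
    (hxq : 2 * x < m * q) :
    1 - Real.exp (-x / 10000) ≤
      μ.real {ω | x / 2 ≤ ∑ i, (W i ω).1 ∧ ∑ i, (W i ω).2 ≤ s} := by
  classical
  set U : Fin m → Ω → ℝ := fun i ω => (W i ω).1 with hUdef
  set V : Fin m → Ω → ℝ := fun i ω => (W i ω).2 with hVdef
  have hU : ∀ i, Measurable (U i) := fun i => measurable_fst.comp (hW i)
  have hV : ∀ i, Measurable (V i) := fun i => measurable_snd.comp (hW i)
  have hUi : iIndepFun U μ := hind.comp (fun _ => Prod.fst) (fun _ => measurable_fst)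
  have hVi : iIndepFun V μ := hind.comp (fun _ => Prod.snd) (fun _ => measurable_snd)
  have hU01 : ∀ i ω, 0 ≤ U i ω ∧ U i ω ≤ 1 := fun i ω => by
    rcases h1 i ω with h | h <;> simp [hUdef, h]
  have hV01 : ∀ i ω, 0 ≤ V i ω ∧ V i ω ≤ 1 := fun i ω => by
    rcases h2 i ω with h | h <;> simp [hVdef, h]
  set N : Ω → ℝ := fun ω => ∑ i, U i ω with hN
  set M : Ω → ℝ := fun ω => ∑ i, V i ω with hM
  have hNm : Measurable N := Finset.measurable_fun_sum _ fun i _ => hU i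
  have hMm : Measurable M := Finset.measurable_fun_sum _ fun i _ => hV i
  set F : Set Ω := {ω | x / 2 ≤ N ω ∧ M ω ≤ s} with hF
  have hFm : MeasurableSet F :=
    (measurableSet_le measurable_const hNm).inter (measurableSet_le hMm measurable_const)
  have hN0 : ∀ ω, 0 ≤ N ω := fun ω => Finset.sum_nonneg fun i _ => (hU01 i ω).1
  have hNle : ∀ ω, N ω ≤ m := fun ω => by
    calc N ω ≤ ∑ i : Fin m, (1 : ℝ) := Finset.sum_le_sum fun i _ => (hU01 i ω).2
      _ = m := by simp
  have hM0 : ∀ ω, 0 ≤ M ω := fun ω => Finset.sum_nonneg fun i _ => (hV01 i ω).1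
  have hMle : ∀ ω, M ω ≤ m := fun ω => by
    calc M ω ≤ ∑ i : Fin m, (1 : ℝ) := Finset.sum_le_sum fun i _ => (hV01 i ω).2
      _ = m := by simp
  set y : ℝ := m * a with hy
  set u : ℝ := m * q with hu
  change 1 - Real.exp (-x / 10000) ≤ μ.real F
  rcases le_or_gt x 12 with hx12 | hx12
  · -- second moment regime
    -- truncated first moment
    have hNint : Integrable N μ := Integrable.of_bound hNm.aestronglyMeasurable m
      (Filter.Eventually.of_forall fun ω => by
        rw [Real.norm_eq_abs, abs_of_nonneg (hN0 ω)]; exact hNle ω)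
    have hN2int : Integrable (fun ω => N ω ^ 2) μ :=
      Integrable.of_bound (hNm.pow_const 2).aestronglyMeasurable ((m : ℝ) ^ 2)
      (Filter.Eventually.of_forall fun ω => by
        rw [Real.norm_eq_abs, abs_of_nonneg (sq_nonneg _)]
        exact pow_le_pow_left₀ (hN0 ω) (hNle ω) 2)
    have hN2 : ∫ ω, N ω ^ 2 ∂μ ≤ y + y ^ 2 := by
      have := uas_sq μ m U hU hUi h1 a ha Finset.univ 0
      simpa using this
    set b : ℝ := u - 2 with hb
    set D : ℝ := u / 2 + 2 with hD
    have hupos : 0 < u := by linarith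
    have hDpos : 0 < D := by positivity
    let R : Fin m → Ω → ℝ := fun j ω => ∑ i ∈ Finset.univ.erase j, V i ω
    have hRm : ∀ j, Measurable (R j) := fun j => Finset.measurable_fun_sum _ fun i _ => hV i
    have hR0 : ∀ j ω, 0 ≤ R j ω := fun j ω => Finset.sum_nonneg fun i _ => (hV01 i ω).1
    have hRM : ∀ j ω, R j ω + V j ω = M ω := fun j ω =>
      Finset.sum_erase_add _ _ (Finset.mem_univ j)
    have hRle : ∀ j ω, R j ω ≤ m := fun j ω => by
      have := hRM j ω; have := hMle ω; have := (hV01 j ω).1; linarith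
    have hRind : ∀ j, ∫ ω, U j ω * (R j ω - b) ^ 2 ∂μ = a * ∫ ω, (R j ω - b) ^ 2 ∂μ := by
      intro j
      have h := (iIndepFun.indepFun_finsetSum_of_notMem hind hW
        (Finset.notMem_erase j Finset.univ)).symm
      have h' := h.comp (φ := fun p : ℝ × ℝ => p.1) (ψ := fun p : ℝ × ℝ => (p.2 - b) ^ 2)
        measurable_fst (by fun_prop)
      have e : ((fun p : ℝ × ℝ => (p.2 - b) ^ 2) ∘ (∑ i ∈ Finset.univ.erase j, W i))
          = fun ω => (R j ω - b) ^ 2 := by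
        funext ω
        simp [R, V, Prod.snd_sum, Finset.sum_apply]
      rw [e] at h'
      have := IndepFun.integral_fun_mul_eq_mul_integral h' (hU j).aestronglyMeasurable
        (((hRm j).sub_const b).pow_const 2).aestronglyMeasurable
      rw [← ha j]
      exact this
    have hRsq : ∀ j, ∫ ω, (R j ω - b) ^ 2 ∂μ ≤ u + 4 := by
      intro j
      have := uas_sq μ m V hV hVi h2 q hq (Finset.univ.erase j) b
      refine this.trans ?_
      have hm1 : 1 ≤ m := by have := j.2; omega
      rw [Finset.card_erase_of_mem (Finset.mem_univ j), Finset.card_univ, Fintype.card_fin,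
        Nat.cast_sub hm1]
      have : ((m : ℝ) - (1 : ℕ)) * q = u - q := by push_cast; rw [hu]; ring
      rw [this, hb]
      nlinarith
    -- pointwise bound
    have hpt : ∀ j ω, U j ω - U j ω * (R j ω - b) ^ 2 / D ^ 2 ≤
        U j ω * (if M ω ≤ s then 1 else 0) := by
      intro j ω
      rcases h1 j ω with h | h
      · have : U j ω = 0 := h
        simp [this]
      · have hUj : U j ω = 1 := h
        have hVj : V j ω = 1 := le_antisymm (hV01 j ω).2 (by
          have := h12 j ω; rw [h] at this; exact this)
        rw [hUj]
        split_ifs with hs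
        · have : 0 ≤ (R j ω - b) ^ 2 / D ^ 2 := by positivity
          simp only [one_mul, mul_one]; linarith
        · have hk := hRM j ω
          obtain ⟨k, hk'⟩ := uas_nat (Finset.univ.erase j) (fun i => V i ω) (fun i => h2 i ω)
          have hk2 : R j ω = k := hk'
          rw [hVj] at hk
          have hsk : s < k + 1 := by
            have : (s : ℝ) < (k : ℝ) + 1 := by rw [← hk2, hk]; exact not_le.mp hs
            exact_mod_cast this
          have hsk' : (s : ℝ) ≤ R j ω := by rw [hk2]; exact_mod_cast Nat.lt_succ_iff.mp hsk
          have hDR : D ≤ R j ω - b := by rw [hD, hb]; linarith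
          have : D ^ 2 ≤ (R j ω - b) ^ 2 := pow_le_pow_left₀ hDpos.le hDR 2
          have : 1 ≤ (R j ω - b) ^ 2 / D ^ 2 := (one_le_div (by positivity)).2 this
          simp only [one_mul, mul_zero]; linarith
    have hUint : ∀ i, Integrable (U i) μ := fun i =>
      Integrable.of_bound (hU i).aestronglyMeasurable 1
      (Filter.Eventually.of_forall fun ω => by
        rw [Real.norm_eq_abs, abs_of_nonneg (hU01 i ω).1]; exact (hU01 i ω).2)
    have hURint : ∀ j, Integrable (fun ω => U j ω * (R j ω - b) ^ 2) μ := fun j =>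
      Integrable.of_bound ((hU j).mul (((hRm j).sub_const b).pow_const 2)).aestronglyMeasurable
        ((m + |b|) ^ 2)
      (Filter.Eventually.of_forall fun ω => by
        rw [Real.norm_eq_abs, abs_of_nonneg (mul_nonneg (hU01 j ω).1 (sq_nonneg _))]
        have e1 : |R j ω - b| ≤ m + |b| := by
          refine (abs_sub _ _).trans ?_
          rw [abs_of_nonneg (hR0 j ω)]
          have := hRle j ω
          linarith
        have e2 : (R j ω - b) ^ 2 ≤ (m + |b|) ^ 2 := by
          rw [← sq_abs (R j ω - b)]
          exact pow_le_pow_left₀ (abs_nonneg _) e1 2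
        calc U j ω * (R j ω - b) ^ 2 ≤ 1 * (R j ω - b) ^ 2 :=
              mul_le_mul_of_nonneg_right (hU01 j ω).2 (sq_nonneg _)
          _ ≤ _ := by rw [one_mul]; exact e2)
    -- choose threshold
    obtain ⟨θ, hθ0, hθ1, hθ2⟩ : ∃ θ : ℝ, 0 ≤ θ ∧ θ ≤ y * (u / (u + 4)) - y / 26 ∧
        ∀ ω, N ω * (if M ω ≤ s then 1 else 0) ≤ θ + N ω * F.indicator 1 ω := by
      have hy0 : 0 < y := by linarith
      rcases lt_or_ge x 2 with hx2 | hx2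
      · refine ⟨0, le_rfl, ?_, ?_⟩
        · have hs1 : 1 ≤ s := by
            rcases Nat.eq_zero_or_pos s with h | h
            · rw [h] at hsq; norm_num at hsq; linarith
            · exact h
          have hs1' : (1 : ℝ) ≤ s := by exact_mod_cast hs1
          have : 1 / 26 ≤ u / (u + 4) := by
            rw [div_le_div_iff₀ (by norm_num) (by linarith)]; linarith
          nlinarith
        · intro ω
          by_cases hs : M ω ≤ s
          · by_cases h0 : N ω = 0
            · simp [h0]
            · have hF' : ω ∈ F := by
                refine ⟨?_, hs⟩
                obtain ⟨k, hk⟩ := uas_nat Finset.univ (fun i => U i ω) (fun i => h1 i ω)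
                have hk : N ω = k := hk
                have : 1 ≤ k := by
                  rcases Nat.eq_zero_or_pos k with h | h
                  · exact absurd (by rw [hk, h]; simp) h0
                  · exact h
                have : (1 : ℝ) ≤ k := by exact_mod_cast this
                rw [hk]; linarith
              simp [hs, hF']
          · have : ω ∉ F := fun h => hs h.2
            simp [hs, this]
      · refine ⟨x / 2, by linarith, ?_, ?_⟩
        · have hs6 : (6 : ℝ) < s := by rw [hsq]; linarith
          have hs7 : 7 ≤ s := by
            have : 6 < s := by exact_mod_cast hs6
            omega
          have hs7' : (7 : ℝ) ≤ s := by exact_mod_cast hs7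
          have : 7 / 13 ≤ u / (u + 4) := by
            rw [div_le_div_iff₀ (by norm_num) (by linarith)]; linarith
          nlinarith
        · intro ω
          by_cases hs : M ω ≤ s
          · by_cases hF' : ω ∈ F
            · simp [hs, hF']; linarith
            · have : N ω < x / 2 := by
                by_contra hc
                exact hF' ⟨not_lt.mp hc, hs⟩
              simp [hs, hF']; linarith
          · have h0 : ω ∉ F := fun h => hs h.2
            simp [hs, h0]; linarith
    have hy0 : 0 < y := by linarith
    set ε : ℝ := 1 / (26 * (1 + y)) with hε
    have hεpos : 0 < ε := by positivity
    have key : ∀ ω, ∑ j, (U j ω - U j ω * (R j ω - b) ^ 2 / D ^ 2) ≤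
        θ + (ε / 2 * N ω ^ 2 + F.indicator 1 ω * (1 / (2 * ε))) := by
      intro ω
      calc ∑ j, (U j ω - U j ω * (R j ω - b) ^ 2 / D ^ 2)
          ≤ ∑ j, U j ω * (if M ω ≤ s then 1 else 0) := Finset.sum_le_sum fun j _ => hpt j ω
        _ = N ω * (if M ω ≤ s then 1 else 0) := by rw [Finset.sum_mul]
        _ ≤ _ := hθ2 ω
        _ ≤ _ := by
          by_cases hF' : ω ∈ F
          · simp only [hF', Set.indicator_of_mem, Pi.one_apply, mul_one, one_mul]
            have : N ω ≤ ε / 2 * N ω ^ 2 + 1 / (2 * ε) := by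
              have e : ε / 2 * N ω ^ 2 + 1 / (2 * ε) - N ω = (ε * N ω - 1) ^ 2 / (2 * ε) := by
                field_simp; ring
              have : 0 ≤ (ε * N ω - 1) ^ 2 / (2 * ε) := by positivity
              linarith
            linarith
          · simp only [hF', not_false_eq_true, Set.indicator_of_notMem, mul_zero, zero_mul]
            have : 0 ≤ ε / 2 * N ω ^ 2 := by positivity
            linarith
    have hFint : Integrable (F.indicator (1 : Ω → ℝ)) μ :=
      (integrable_const (1 : ℝ)).indicator hFm
    have hLint : ∀ j, Integrable (fun ω => U j ω - U j ω * (R j ω - b) ^ 2 / D ^ 2) μ :=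
      fun j => (hUint j).sub ((hURint j).div_const _)
    have hI := integral_mono (μ := μ) (integrable_finsetSum Finset.univ (fun j _ => hLint j))
      ((integrable_const θ).add ((hN2int.const_mul (ε / 2)).add
        (hFint.mul_const (1 / (2 * ε))))) key
    have hR1 : ∫ ω, (θ + (ε / 2 * N ω ^ 2 + F.indicator 1 ω * (1 / (2 * ε)))) ∂μ
        = θ + (ε / 2 * ∫ ω, N ω ^ 2 ∂μ + μ.real F * (1 / (2 * ε))) := by
      have hi3 : Integrable
          (fun ω => ε / 2 * N ω ^ 2 + F.indicator 1 ω * (1 / (2 * ε))) μ :=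
        (hN2int.const_mul (ε / 2)).add (hFint.mul_const (1 / (2 * ε)))
      rw [integral_add (integrable_const θ) hi3, integral_add (hN2int.const_mul (ε / 2))
        (hFint.mul_const (1 / (2 * ε))), integral_const_mul, integral_mul_const,
        integral_indicator_one hFm]
      simp
    have hL1 : y * (u / (u + 4)) ≤
        ∫ ω, ∑ j, (U j ω - U j ω * (R j ω - b) ^ 2 / D ^ 2) ∂μ := by
      rw [integral_finsetSum _ (fun j _ => hLint j)]
      have : ∀ j ∈ Finset.univ, a * (u / (u + 4)) ≤
          ∫ ω, (U j ω - U j ω * (R j ω - b) ^ 2 / D ^ 2) ∂μ := by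
        intro j _
        rw [integral_sub (hUint j) ((hURint j).div_const _), integral_div, hRind j]
        have e1 : ∫ ω, U j ω ∂μ = a := ha j
        rw [e1]
        have e2 : a * ∫ ω, (R j ω - b) ^ 2 ∂μ ≤ a * (u + 4) :=
          mul_le_mul_of_nonneg_left (hRsq j) ha0
        have e3 : (a * ∫ ω, (R j ω - b) ^ 2 ∂μ) / D ^ 2 ≤ a * (u + 4) / D ^ 2 := by gcongr
        have e4 : a - a * (u + 4) / D ^ 2 = a * (u / (u + 4)) := by
          rw [hD]; field_simp; ring
        linarith
      calc y * (u / (u + 4)) = ∑ j : Fin m, a * (u / (u + 4)) := by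
            simp [hy]; ring
        _ ≤ _ := Finset.sum_le_sum this
    have hfin : y / 26 ≤ ε / 2 * (y + y ^ 2) + μ.real F * (1 / (2 * ε)) := by
      have : ε / 2 * ∫ ω, N ω ^ 2 ∂μ ≤ ε / 2 * (y + y ^ 2) :=
        mul_le_mul_of_nonneg_left hN2 (by positivity)
      have h3 := hL1.trans (hI.trans_eq hR1)
      linarith
    have e5 : ε / 2 * (y + y ^ 2) = y / 52 := by rw [hε]; field_simp; norm_num
    have e6 : 1 / (2 * ε) = 13 * (1 + y) := by rw [hε]; field_simp; norm_num
    rw [e5, e6] at hfin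
    have hp : x / 10000 ≤ μ.real F := by
      have hp0 : 0 ≤ μ.real F := measureReal_nonneg
      by_contra hc
      push Not at hc
      have : μ.real F * (13 * (1 + y)) ≤ x / 10000 * (13 * (1 + y)) := by gcongr
      nlinarith
    have := Real.add_one_le_exp (-x / 10000)
    linarith
  · -- Chernoff regime
    have hbI : ∀ (Z : Ω → ℝ), Measurable Z → (∀ ω, 0 ≤ Z ω) → (∀ ω, Z ω ≤ m) → ∀ t : ℝ,
        Integrable (fun ω => Real.exp (t * Z ω)) μ := by
      intro Z hZ h0 h1 t
      refine Integrable.of_bound (by fun_prop) (Real.exp (|t| * m))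
        (Filter.Eventually.of_forall fun ω => ?_)
      rw [Real.norm_eq_abs, abs_of_pos (Real.exp_pos _)]
      apply Real.exp_le_exp.2
      calc t * Z ω ≤ |t| * Z ω := mul_le_mul_of_nonneg_right (le_abs_self t) (h0 ω)
        _ ≤ _ := mul_le_mul_of_nonneg_left (h1 ω) (abs_nonneg t)
    have eN : (∑ i, U i) = N := by funext ω; simp [hN]
    have eM : (∑ i, V i) = M := by funext ω; simp [hM]
    have c1 : μ.real {ω | N ω ≤ x / 2} ≤ Real.exp (-(13 / 100) * x) := by
      refine (measure_le_le_exp_mul_mgf (t := -1) (x / 2) (by norm_num)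
        (hbI N hNm hN0 hNle _)).trans ?_
      have := uas_mgf μ m U hU hUi h1 a ha (-1)
      rw [eN] at this
      refine (mul_le_mul_of_nonneg_left this (Real.exp_pos _).le).trans ?_
      rw [← Real.exp_add]
      apply Real.exp_le_exp.2
      have he : Real.exp (-1) ≤ 37 / 100 := by
        rw [Real.exp_neg, inv_le_comm₀ (Real.exp_pos _) (by norm_num)]
        have := Real.exp_one_gt_d9
        norm_num at this ⊢; linarith
      nlinarith
    have c2 : μ.real {ω | (s : ℝ) ≤ M ω} ≤ Real.exp (-(13 / 100) * x) := by
      refine (measure_ge_le_exp_mul_mgf (t := 2 / 5) (s : ℝ) (by norm_num)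
        (hbI M hMm hM0 hMle _)).trans ?_
      have := uas_mgf μ m V hV hVi h2 q hq (2 / 5)
      rw [eM] at this
      refine (mul_le_mul_of_nonneg_left this (Real.exp_pos _).le).trans ?_
      rw [← Real.exp_add]
      apply Real.exp_le_exp.2
      have he : Real.exp (2 / 5) ≤ 3 / 2 := by
        have h5 : Real.exp (2 / 5) ^ 5 = Real.exp 1 ^ 2 := by
          rw [← Real.exp_nat_mul, ← Real.exp_nat_mul]; norm_num
        have h3 := Real.exp_one_lt_d9
        by_contra hc
        push Not at hc
        have h6 : (3 / 2 : ℝ) ^ 5 ≤ Real.exp (2 / 5) ^ 5 :=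
          pow_le_pow_left₀ (by norm_num) hc.le 5
        have h7 : Real.exp 1 ^ 2 ≤ (2.7182818286 : ℝ) ^ 2 :=
          pow_le_pow_left₀ (Real.exp_pos _).le h3.le 2
        rw [h5] at h6
        norm_num at h6 h7
        linarith
      have : u * (Real.exp (2 / 5) - 1) ≤ u * (1 / 2) :=
        mul_le_mul_of_nonneg_left (by linarith) (by linarith)
      change -(2 / 5) * (s : ℝ) + u * (Real.exp (2 / 5) - 1) ≤ _
      rw [hsq]
      linarith
    have hsub : Fᶜ ⊆ {ω | N ω ≤ x / 2} ∪ {ω | (s : ℝ) ≤ M ω} := by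
      intro ω hω
      by_contra hc
      simp only [Set.mem_union, Set.mem_ofPred_eq, not_or, not_le] at hc
      exact hω ⟨hc.1.le, hc.2.le⟩
    have hc : μ.real Fᶜ ≤ 2 * Real.exp (-(13 / 100) * x) := by
      calc μ.real Fᶜ ≤ μ.real ({ω | N ω ≤ x / 2} ∪ {ω | (s : ℝ) ≤ M ω}) :=
            measureReal_mono hsub
        _ ≤ _ := measureReal_union_le _ _
        _ ≤ _ := by linarith
    rw [probReal_compl_eq_one_sub hFm] at hc
    have h2e : (2 : ℝ) ≤ Real.exp (x / 10) := by
      have := Real.add_one_le_exp (x / 10); linarith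
    have : 2 * Real.exp (-(13 / 100) * x) ≤ Real.exp (-x / 10000) := by
      calc 2 * Real.exp (-(13 / 100) * x) ≤ Real.exp (x / 10) * Real.exp (-(13 / 100) * x) := by
            gcongr
        _ = Real.exp (x / 10 + -(13 / 100) * x) := by rw [Real.exp_add]
        _ ≤ _ := Real.exp_le_exp.2 (by linarith)
    linarith


/-- Uniform-Adaptive Sampling lemma for MEB with outliers. -/
theorem uniform_adaptive_sampling :
    ∃ c : ℝ, 0 < c ∧
      ∀ (d n : ℕ) (P : Finset (EuclideanSpace ℝ (Fin d))) (hne : P.Nonempty),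
        P.card = n →
        ∀ γ δ η : ℝ, γ ∈ Set.Ioo (0 : ℝ) 1 → δ ∈ Set.Ioo (0 : ℝ) 1 →
          η ∈ Set.Ioo (0 : ℝ) 1 →
        ∀ Popt : Finset (EuclideanSpace ℝ (Fin d)), Popt ⊆ P →
          (Popt.card : ℝ) = (1 - γ) * n →
        ∀ o : EuclideanSpace ℝ (Fin d),
          (∀ p ∈ P, ∀ q ∈ P, p ≠ q → dist p o ≠ dist q o) →
        ∀ t : ℕ, (t : ℝ) = (1 + δ) * γ * n → t ≤ n →
        ∀ Q : Finset (EuclideanSpace ℝ (Fin d)), Q ⊆ P → Q.card = t →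
          (∀ p ∈ Q, ∀ q ∈ P, q ∉ Q → dist q o < dist p o) →
        ∀ m : ℕ, c * (1 / (δ * γ)) * Real.log (1 / η) ≤ (m : ℝ) →
        ∀ t' : ℕ, (t' : ℝ) = (3 / 2) * (1 + δ) * γ * m → t' ≤ m →
        ∀ Q' : (Fin m → EuclideanSpace ℝ (Fin d)) → Finset (Fin m),
          (∀ X : Fin m → EuclideanSpace ℝ (Fin d),
            (Q' X).card = t' ∧
            ∀ j ∈ Q' X, ∀ j', j' ∉ Q' X → dist (X j') o ≤ dist (X j) o) →
        ENNReal.ofReal (1 - η) ≤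
          Measure.pi (fun _ : Fin m => (PMF.uniformOfFinset P hne).toMeasure)
            {X : Fin m → EuclideanSpace ℝ (Fin d) |
              δ / (3 * (1 + δ)) * (t' : ℝ) ≤
                (({j : Fin m | j ∈ Q' X ∧ X j ∈ Popt ∧ X j ∈ Q}).ncard : ℝ)} := by

  classical
  refine ⟨10000, by norm_num, ?_⟩
  intro d n P hne hn γ δ η hγ hδ hη Popt hPopt hPc o hdist t ht htn Q hQP hQc hQfar m hm t' ht'
    ht'm Q' hQ'
  obtain ⟨hγ0, hγ1⟩ := hγ
  obtain ⟨hδ0, hδ1⟩ := hδ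
  obtain ⟨hη0, hη1⟩ := hη
  set ν : Measure (EuclideanSpace ℝ (Fin d)) := (PMF.uniformOfFinset P hne).toMeasure with hν
  have hνp : IsProbabilityMeasure ν := PMF.toMeasure.isProbabilityMeasure _
  have hn0 : 0 < n := by rw [← hn]; exact hne.card_pos
  have hn0' : (0 : ℝ) < n := by exact_mod_cast hn0
  have hνS : ∀ S : Finset (EuclideanSpace ℝ (Fin d)), S ⊆ P →
      ν.real (S : Set (EuclideanSpace ℝ (Fin d))) = S.card / n := by
    intro S hS
    rw [Measure.real, hν, PMF.toMeasure_uniformOfFinset_apply _ _ S.measurableSet]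
    have : {x ∈ P | x ∈ (S : Set (EuclideanSpace ℝ (Fin d)))} = S := by
      ext p; simp; exact fun h => hS h
    have e : ((S.card : ENNReal) / (P.card : ENNReal)).toReal = (S.card : ℝ) / n := by
      rw [hn]; simp
    rw [← e]
    conv_rhs => rw [← this]
    congr!
  set A : Finset (EuclideanSpace ℝ (Fin d)) := Popt ∩ Q with hA
  have hAP : A ⊆ P := Finset.inter_subset_left.trans hPopt
  have hAc : δ * γ * n ≤ A.card := by
    have h1 : (Popt ∪ Q).card ≤ n := by
      rw [← hn]; exact Finset.card_le_card (Finset.union_subset hPopt hQP)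
    have h2 := Finset.card_union_add_card_inter Popt Q
    have h1' : ((Popt ∪ Q).card : ℝ) ≤ n := by exact_mod_cast h1
    have h2' : ((Popt ∪ Q).card : ℝ) + A.card = Popt.card + Q.card := by exact_mod_cast h2
    rw [hPc, hQc, ht] at h2'
    nlinarith
  have hlog : 0 < Real.log (1 / η) := Real.log_pos (by rw [lt_div_iff₀ hη0]; linarith)
  have hδγ : 0 < δ * γ := mul_pos hδ0 hγ0
  set x : ℝ := δ * γ * m with hx
  have hxlog : 10000 * Real.log (1 / η) ≤ x := by
    have := mul_le_mul_of_nonneg_left hm hδγ.le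
    calc 10000 * Real.log (1 / η) = δ * γ * (10000 * (1 / (δ * γ)) * Real.log (1 / η)) := by
          field_simp
      _ ≤ _ := this
  have hx0 : 0 < x := by linarith
  have hm0 : (0 : ℝ) < m := by
    by_contra hc
    have : (m : ℝ) = 0 := le_antisymm (not_lt.mp hc) (Nat.cast_nonneg m)
    rw [hx, this] at hx0; simp at hx0
  let f : EuclideanSpace ℝ (Fin d) → ℝ × ℝ := fun p =>
    ((A : Set (EuclideanSpace ℝ (Fin d))).indicator 1 p,
      (Q : Set (EuclideanSpace ℝ (Fin d))).indicator 1 p)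
  have hf : Measurable f :=
    (measurable_one.indicator A.measurableSet).prodMk (measurable_one.indicator Q.measurableSet)
  let W : Fin m → (Fin m → EuclideanSpace ℝ (Fin d)) → ℝ × ℝ := fun i X => f (X i)
  have hmp : ∀ i : Fin m, MeasurePreserving (Function.eval i)
      (Measure.pi (fun _ : Fin m => ν)) ν := fun i => measurePreserving_eval _ i
  have hcomp : ∀ (S : Finset (EuclideanSpace ℝ (Fin d))) (i : Fin m), S ⊆ P →
      ∫ X : Fin m → EuclideanSpace ℝ (Fin d),
        (S : Set (EuclideanSpace ℝ (Fin d))).indicator (1 : EuclideanSpace ℝ (Fin d) → ℝ) (X i)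
          ∂(Measure.pi (fun _ : Fin m => ν)) = S.card / n := by
    intro S i hS
    rw [← hνS S hS, ← integral_indicator_one S.measurableSet]
    have h := integral_map (μ := Measure.pi (fun _ : Fin m => ν))
      (f := (S : Set (EuclideanSpace ℝ (Fin d))).indicator (1 : EuclideanSpace ℝ (Fin d) → ℝ))
      (hmp i).measurable.aemeasurable
        (measurable_one.indicator S.measurableSet).aestronglyMeasurable
    rw [(hmp i).map_eq] at h
    exact h.symm
  have hind01 : ∀ (S : Set (EuclideanSpace ℝ (Fin d))) p,
      S.indicator (1 : EuclideanSpace ℝ (Fin d) → ℝ) p = 0 ∨ S.indicator (1 : EuclideanSpace ℝ (Fin d) → ℝ) p = 1 := by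
    intro S p
    by_cases h : p ∈ S <;> simp [h]
  have hq : (t : ℝ) / n = (1 + δ) * γ := by rw [ht]; field_simp
  have hcore := uas_core (Measure.pi (fun _ : Fin m => ν)) m W
    (fun i => hf.comp (measurable_pi_apply i))
    (ProbabilityTheory.iIndepFun_pi (fun i => hf.aemeasurable))
    (fun i X => hind01 _ _) (fun i X => hind01 _ _)
    (fun i X => Set.indicator_le_indicator_of_subset
      (by rw [hA]; exact_mod_cast Finset.inter_subset_right) (fun _ => zero_le_one) _)
    (A.card / n) (Q.card / n) (fun i => hcomp A i hAP) (fun i => hcomp Q i hQP)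
    (by rw [div_le_one hn0', hQc]; exact_mod_cast htn) (by positivity) (by positivity)
    t' (by rw [hQc, hq, ht']; ring) x hx0
    (by
      have : δ * γ ≤ A.card / n := by rw [le_div_iff₀ hn0']; exact hAc
      rw [hx, mul_comm]; exact mul_le_mul_of_nonneg_left this hm0.le)
    (by rw [hQc, hq, hx]; nlinarith [mul_pos hγ0 hm0])
  have hexp : Real.exp (-x / 10000) ≤ η := by
    rw [← Real.exp_log hη0]
    apply Real.exp_le_exp.2
    rw [one_div, Real.log_inv] at hxlog
    linarith
  have hae : ∀ᵐ X ∂(Measure.pi (fun _ : Fin m => ν)), ∀ j, X j ∈ P := by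
    rw [ae_all_iff]
    intro j
    have h1 : ∀ᵐ p ∂ν, p ∈ P := by
      have : ν.real (P : Set (EuclideanSpace ℝ (Fin d))) = 1 := by
        rw [hνS P subset_rfl, hn]; field_simp
      have h2 : ν (P : Set (EuclideanSpace ℝ (Fin d))) = 1 := by
        rw [← ENNReal.toReal_eq_one_iff]; exact this
      have := (prob_compl_eq_zero_iff P.measurableSet).2 h2
      exact this
    exact (hmp j).quasiMeasurePreserving.ae h1
  calc ENNReal.ofReal (1 - η)
      ≤ ENNReal.ofReal ((Measure.pi (fun _ : Fin m => ν)).real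
          {X | x / 2 ≤ ∑ i, (W i X).1 ∧ ∑ i, (W i X).2 ≤ t'}) :=
        ENNReal.ofReal_le_ofReal (by linarith)
    _ = (Measure.pi (fun _ : Fin m => ν))
          {X | x / 2 ≤ ∑ i, (W i X).1 ∧ ∑ i, (W i X).2 ≤ t'} := by
        rw [Measure.real, ENNReal.ofReal_toReal (measure_ne_top _ _)]
    _ ≤ _ := by
        refine measure_mono_ae ?_
        filter_upwards [hae] with X hXP hX
        obtain ⟨hX1, hX2⟩ := hX
        have hcard : ∀ S : Finset (EuclideanSpace ℝ (Fin d)),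
            ∑ i, (S : Set (EuclideanSpace ℝ (Fin d))).indicator (1 : EuclideanSpace ℝ (Fin d) → ℝ) (X i)
              = ((Finset.univ.filter fun i => X i ∈ S).card : ℝ) := by
          intro S
          simp [Set.indicator_apply]
        have hX1' : x / 2 ≤ ((Finset.univ.filter fun i => X i ∈ A).card : ℝ) := by
          rw [← hcard A]; exact hX1
        have hX2' : ((Finset.univ.filter fun i => X i ∈ Q).card : ℝ) ≤ t' := by
          rw [← hcard Q]; exact hX2
        have hX2'' : (Finset.univ.filter fun i => X i ∈ Q).card ≤ t' := by exact_mod_cast hX2'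
        obtain ⟨hc, hfar⟩ := hQ' X
        have hall : ∀ j, X j ∈ Q → j ∈ Q' X := by
          intro j hj
          by_contra hjn
          have hsub : insert j (Q' X) ⊆ Finset.univ.filter fun i => X i ∈ Q := by
            intro i hi
            rw [Finset.mem_filter]
            refine ⟨Finset.mem_univ _, ?_⟩
            rcases Finset.mem_insert.1 hi with rfl | hi
            · exact hj
            · by_contra hiQ
              exact absurd (hfar i hi j hjn) (not_le.2 (hQfar _ hj _ (hXP i) hiQ))
          have := Finset.card_le_card hsub
          rw [Finset.card_insert_of_notMem hjn, hc] at this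
          omega
        have hset : {j : Fin m | j ∈ Q' X ∧ X j ∈ Popt ∧ X j ∈ Q}
            = ((Finset.univ.filter fun i => X i ∈ A : Finset (Fin m)) : Set (Fin m)) := by
          ext j
          simp only [Set.mem_ofPred_eq, Finset.coe_filter, Finset.mem_univ, true_and, hA,
            Finset.mem_inter]
          exact ⟨fun h => h.2, fun h => ⟨hall j h.2, h⟩⟩
        change δ / (3 * (1 + δ)) * (t' : ℝ) ≤ _
        rw [hset, Set.ncard_coe_finset]
        refine le_trans (le_of_eq ?_) hX1'
        rw [ht', hx]
        field_simp
end

section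
/- There is an absolute constant c > 0 with the following property (Sandwich Lemma). Let P be a set of n distinct points in ℝ^d, let γ ∈ (0,1), δ ∈ (0,1/3), η ∈ (0,1), and let o ∈ ℝ^d be a point such that the distances ‖p−o‖ for p ∈ P are pairwise distinct. Assume t := (1+δ)γn and ((1+δ)²/(1−δ))·γn are integers with t < n and ((1+δ)²/(1−δ))·γn ≤ n, and let l be the (t+1)-th largest distance from a point of P to o. Let m be an integer with m ≥ c·(1/(δ²γ))·log(1/η) such that k := (1+δ)²γm is an integer with k < m. Let X_1, …, X_m be independent random variables, each uniformly distributed on P, and let l̃ be the (k+1)-th largest value of the multiset {‖X_j − o‖ : 1 ≤ j ≤ m}. Then, with probability at least 1−η, both of the following hold: l̃ ≤ l, and the number of points of P lying outside the closed ball of radius l̃ centered at o is at most ((1+δ)²/(1−δ))·γn. -/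
open MeasureTheory

/-- Expectation of `g` under the binomial distribution with parameters `m`, `p`. -/
noncomputable def Eb (p : ℝ) : ℕ → (ℕ → ℝ) → ℝ
  | 0, g => g 0
  | m + 1, g => p * Eb p m (fun i => g (i + 1)) + (1 - p) * Eb p m g

lemma Eb_add (p : ℝ) (m : ℕ) : ∀ f g : ℕ → ℝ,
    Eb p m (fun i => f i + g i) = Eb p m f + Eb p m g := by
  induction m with
  | zero => intro f g; rfl
  | succ m ih =>
    intro f g
    simp only [Eb]
    rw [ih f g, ih (fun i => f (i + 1)) (fun i => g (i + 1))]
    ring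

lemma Eb_smul (p : ℝ) (m : ℕ) (c : ℝ) : ∀ f : ℕ → ℝ,
    Eb p m (fun i => c * f i) = c * Eb p m f := by
  induction m with
  | zero => intro f; rfl
  | succ m ih =>
    intro f
    simp only [Eb]
    rw [ih f, ih (fun i => f (i + 1))]
    ring

lemma Eb_const (p : ℝ) (m : ℕ) (c : ℝ) : Eb p m (fun _ => c) = c := by
  induction m with
  | zero => rfl
  | succ m ih => simp only [Eb]; rw [ih]; ring

lemma Eb_mono {p : ℝ} (h0 : 0 ≤ p) (h1 : p ≤ 1) (m : ℕ) : ∀ f g : ℕ → ℝ, (∀ i, f i ≤ g i) →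
    Eb p m f ≤ Eb p m g := by
  induction m with
  | zero => intro f g h; exact h 0
  | succ m ih =>
    intro f g h
    simp only [Eb]
    have a := ih f g h
    have b := ih (fun i => f (i + 1)) (fun i => g (i + 1)) (fun i => h _)
    have h2 : 0 ≤ 1 - p := by linarith
    gcongr

lemma Eb_pow (p b : ℝ) (m : ℕ) : Eb p m (fun i => b ^ i) = (p * b + (1 - p)) ^ m := by
  induction m with
  | zero => simp [Eb]
  | succ m ih =>
    simp only [Eb]
    have : (fun i => b ^ (i + 1)) = fun i : ℕ => b * b ^ i := by funext i; ring
    rw [this, Eb_smul, ih]; ring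

lemma Eb_one (p : ℝ) (m : ℕ) : Eb p m (fun i => (i : ℝ) - m * p) = 0 := by
  induction m with
  | zero => simp [Eb]
  | succ m ih =>
    simp only [Eb]
    have h1 : (fun i : ℕ => ((i + 1 : ℕ) : ℝ) - (m + 1 : ℕ) * p)
        = fun i : ℕ => ((i : ℝ) - m * p) + (1 - p) := by funext i; push_cast; ring
    have h2 : (fun i : ℕ => (i : ℝ) - (m + 1 : ℕ) * p)
        = fun i : ℕ => ((i : ℝ) - m * p) + (- p) := by funext i; push_cast; ring
    rw [h1, h2, Eb_add, Eb_add, ih, Eb_const, Eb_const]; ring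

lemma Eb_two (p : ℝ) (m : ℕ) : Eb p m (fun i => ((i : ℝ) - m * p) ^ 2) = m * (p * (1 - p)) := by
  induction m with
  | zero => simp [Eb]
  | succ m ih =>
    simp only [Eb]
    have key : ∀ c : ℝ, Eb p m (fun i => ((i : ℝ) - m * p + c) ^ 2) =
        m * (p * (1 - p)) + c ^ 2 := by
      intro c
      have : (fun i : ℕ => ((i : ℝ) - m * p + c) ^ 2) = fun i : ℕ =>
        (((i : ℝ) - m * p) ^ 2 + (2 * c) * ((i : ℝ) - m * p)) + c ^ 2 := by
          funext i; ring
      rw [this, Eb_add, Eb_add, Eb_smul, Eb_one, Eb_const, ih]; ring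
    have h1 : (fun i : ℕ => (((i + 1 : ℕ) : ℝ) - (m + 1 : ℕ) * p) ^ 2)
        = fun i : ℕ => (((i : ℝ) - m * p) + (1 - p)) ^ 2 := by funext i; push_cast; ring
    have h2 : (fun i : ℕ => ((i : ℝ) - (m + 1 : ℕ) * p) ^ 2)
        = fun i : ℕ => (((i : ℝ) - m * p) + (- p)) ^ 2 := by funext i; push_cast; ring
    rw [h1, h2, key, key]; push_cast; ring

lemma Eb_four (p : ℝ) (m : ℕ) : Eb p m (fun i => ((i : ℝ) - m * p) ^ 4) =
    3 * (m * (p * (1 - p))) ^ 2 + m * (p * (1 - p)) * (1 - 6 * (p * (1 - p))) := by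
  induction m with
  | zero => simp [Eb]
  | succ m ih =>
    simp only [Eb]
    have key : ∀ c : ℝ, Eb p m (fun i => ((i : ℝ) - m * p + c) ^ 4) =
        Eb p m (fun i => ((i : ℝ) - m * p) ^ 4) + 4 * c * Eb p m (fun i => ((i : ℝ) - m * p) ^ 3)
         + 6 * c ^ 2 * (m * (p * (1 - p))) + c ^ 4 := by
      intro c
      have : (fun i : ℕ => ((i : ℝ) - m * p + c) ^ 4) = fun i : ℕ =>
        (((((i : ℝ) - m * p) ^ 4 + (4 * c) * ((i : ℝ) - m * p) ^ 3)
          + (6 * c ^ 2) * ((i : ℝ) - m * p) ^ 2) + (4 * c ^ 3) * ((i : ℝ) - m * p)) + c ^ 4 := by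
          funext i; ring
      rw [this, Eb_add, Eb_add, Eb_add, Eb_add, Eb_smul, Eb_smul, Eb_smul, Eb_one, Eb_const,
        Eb_two]; ring
    have h1 : (fun i : ℕ => (((i + 1 : ℕ) : ℝ) - (m + 1 : ℕ) * p) ^ 4)
        = fun i : ℕ => (((i : ℝ) - m * p) + (1 - p)) ^ 4 := by funext i; push_cast; ring
    have h2 : (fun i : ℕ => ((i : ℝ) - (m + 1 : ℕ) * p) ^ 4)
        = fun i : ℕ => (((i : ℝ) - m * p) + (- p)) ^ 4 := by funext i; push_cast; ring
    rw [h1, h2, key, key, ih]; push_cast; ring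

/-- Binomial tail. -/
noncomputable def Fb (m k : ℕ) (p : ℝ) : ℝ := Eb p m (fun i => if k < i then 1 else 0)

lemma Fb_le {p b : ℝ} (h0 : 0 ≤ p) (h1 : p ≤ 1) (hb : 1 ≤ b) (m k : ℕ) :
    Fb m k p * b ^ k ≤ (p * b + (1 - p)) ^ m := by
  rw [← Eb_pow, mul_comm, Fb, ← Eb_smul]
  apply Eb_mono h0 h1
  intro i
  split_ifs with h
  · simpa using pow_le_pow_right₀ hb h.le
  · simp; positivity

lemma Fb_ge {p b : ℝ} (h0 : 0 ≤ p) (h1 : p ≤ 1) (hb0 : 0 < b) (hb : b ≤ 1) (m k : ℕ) :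
    (1 - Fb m k p) * b ^ k ≤ (p * b + (1 - p)) ^ m := by
  have : (1 - Fb m k p) = Eb p m (fun i => 1 + (-1) * (if k < i then 1 else 0)) := by
    rw [Eb_add, Eb_smul, Eb_const, Fb]; ring
  rw [← Eb_pow, mul_comm, this, ← Eb_smul]
  apply Eb_mono h0 h1
  intro i
  split_ifs with h
  · simp; positivity
  · simpa using pow_le_pow_of_le_one hb0.le hb (not_lt.mp h)

lemma Fb_nonneg {p : ℝ} (h0 : 0 ≤ p) (h1 : p ≤ 1) (m k : ℕ) : 0 ≤ Fb m k p := by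
  rw [← Eb_const p m 0, Fb]
  apply Eb_mono h0 h1
  intro i; split_ifs <;> norm_num

lemma Fb_zero (m k : ℕ) : Fb m k 0 = 0 := by
  have : ∀ (m : ℕ) (g : ℕ → ℝ), Eb 0 m g = g 0 := by
    intro m
    induction m with
    | zero => intro g; rfl
    | succ m ih => intro g; simp [Eb, ih]
  simp [Fb, this]

lemma chern_up {p θ : ℝ} (h0 : 0 ≤ p) (h1 : p ≤ 1) (hθ : 0 < θ) (m k : ℕ)
    (h : (m : ℝ) * p = k / (1 + θ)) :
    Fb m k p ≤ Real.exp (- (k * (θ ^ 2 / ((2 + θ) * (1 + θ))))) := by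
  have a := Fb_le h0 h1 (b := 1 + θ) (by linarith) m k
  have b : (p * (1 + θ) + (1 - p)) ^ m ≤ Real.exp (k / (1 + θ) * θ) := by
    calc _ ≤ (Real.exp (p * θ)) ^ m := by
          gcongr
          linarith [Real.add_one_le_exp (p * θ)]
      _ = _ := by rw [← Real.exp_nat_mul, ← h]; ring_nf
  have c : (1 + θ) ^ k = Real.exp (k * Real.log (1 + θ)) := by
    rw [Real.exp_nat_mul, Real.exp_log (by linarith)]
  have d := Real.le_log_one_add_of_nonneg hθ.le
  rw [c] at a
  rw [← mul_le_mul_iff_left₀ (Real.exp_pos (k * Real.log (1 + θ)))]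
  refine (a.trans b).trans ?_
  rw [← Real.exp_add]
  apply Real.exp_le_exp.mpr
  have e : 2 * θ / (θ + 2) - θ ^ 2 / ((2 + θ) * (1 + θ)) = θ / (1 + θ) := by
    field_simp; ring
  have : (k : ℝ) * (θ / (1 + θ)) ≤ k * (Real.log (1 + θ) - θ ^ 2 / ((2 + θ) * (1 + θ))) := by
    gcongr; linarith
  calc _ = (k : ℝ) * (θ / (1 + θ)) := by ring
    _ ≤ _ := this
    _ = _ := by ring

lemma chern_low {p δ : ℝ} (h0 : 0 ≤ p) (h1 : p ≤ 1) (hδ : 0 < δ) (hδ1 : δ < 1) (m k : ℕ)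
    (h : (m : ℝ) * p = k / (1 - δ)) :
    1 - Fb m k p ≤ Real.exp (- (k * (δ ^ 2 / 2))) := by
  have a := Fb_ge h0 h1 (b := 1 - δ) (by linarith) (by linarith) m k
  have b : (p * (1 - δ) + (1 - p)) ^ m ≤ Real.exp (- (k / (1 - δ) * δ)) := by
    calc _ ≤ (Real.exp (- (p * δ))) ^ m := by
          gcongr
          linarith [Real.add_one_le_exp (- (p * δ))]
      _ = _ := by rw [← Real.exp_nat_mul, ← h]; ring_nf
  have c : (1 - δ) ^ k = Real.exp (k * Real.log (1 - δ)) := by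
    rw [Real.exp_nat_mul, Real.exp_log (by linarith)]
  have d := Real.abs_log_sub_add_sum_range_le (x := δ) (by rw [abs_of_pos hδ]; exact hδ1) 2
  rw [abs_of_pos hδ] at d
  have d := (abs_le.mp d).1
  simp [Finset.sum_range_succ] at d
  rw [c] at a
  rw [← mul_le_mul_iff_left₀ (Real.exp_pos (k * Real.log (1 - δ)))]
  refine (a.trans b).trans ?_
  rw [← Real.exp_add]
  apply Real.exp_le_exp.mpr
  have hp : 0 < 1 - δ := by linarith
  have e : δ / (1 - δ) = δ + δ ^ 2 + δ ^ 3 / (1 - δ) := by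
    field_simp; ring
  have : (k : ℝ) * (δ ^ 2 / 2 - Real.log (1 - δ)) ≤ k * (δ / (1 - δ)) := by
    gcongr
    norm_num at d
    linarith
  have f : (k : ℝ) / (1 - δ) * δ = k * (δ / (1 - δ)) := by ring
  rw [f]; linarith

lemma Fb_mid (m k : ℕ) (hk : 1 ≤ k) (hkm : k < m) : 1 / 24 ≤ Fb m k ((k : ℝ) / m) := by
  have hm : (0 : ℝ) < m := by exact_mod_cast (by omega : 0 < m)
  have hk' : (1 : ℝ) ≤ k := by exact_mod_cast hk
  have hkm' : (k : ℝ) + 1 ≤ m := by exact_mod_cast hkm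
  set p : ℝ := (k : ℝ) / m with hp
  have hmp : (m : ℝ) * p = k := by rw [hp]; field_simp
  have h0 : 0 ≤ p := by positivity
  have h1 : p ≤ 1 := by rw [hp, div_le_one hm]; linarith
  set v : ℝ := m * (p * (1 - p)) with hv
  have hv2 : 1 / 2 ≤ v := by
    have : v = k * (m - k) / m := by rw [hv, hp]; field_simp
    rw [this, le_div_iff₀ hm]
    nlinarith
  have hvp : 0 < v := by linarith
  obtain ⟨s, hs, hsv⟩ : ∃ s : ℝ, 0 < s ∧ s ^ 2 = v := ⟨√v, Real.sqrt_pos.mpr hvp, Real.sq_sqrt hvp.le⟩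
  have E : Eb p m (fun i => ((1 / (4 * s)) * ((i : ℝ) - m * p)
      + (1 / (4 * s ^ 2)) * ((i : ℝ) - m * p) ^ 2)
      + (-(1 / (24 * s ^ 4))) * ((i : ℝ) - m * p) ^ 4) ≤ Fb m k p := by
    apply Eb_mono h0 h1
    intro i
    rw [hmp]
    set z : ℝ := ((i : ℝ) - k) / s with hz
    have : (i : ℝ) - k = z * s := by rw [hz]; field_simp
    rw [this]
    have e : 1 / (4 * s) * (z * s) + 1 / (4 * s ^ 2) * (z * s) ^ 2 +
        -(1 / (24 * s ^ 4)) * (z * s) ^ 4 = (z + z ^ 2 - z ^ 4 / 6) / 4 := by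
      field_simp; ring
    rw [e]
    split_ifs with h
    · nlinarith [sq_nonneg (z ^ 2 - 15 / 4), sq_nonneg (z - 2)]
    · have : z ≤ 0 := by
        rw [hz]; apply div_nonpos_of_nonpos_of_nonneg _ hs.le
        have : (i : ℝ) ≤ k := by exact_mod_cast not_lt.mp h
        linarith
      clear_value z
      obtain ⟨w, rfl⟩ : ∃ w, z = -w := ⟨-z, by ring⟩
      have hw : 0 ≤ w := by linarith
      have : 0 ≤ w ^ 3 / 6 - w + 1 := by
        nlinarith [mul_nonneg hw (sq_nonneg (w - 3/2)), sq_nonneg (w - 3/2)]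
      nlinarith [mul_nonneg hw this]
  refine le_trans ?_ E
  rw [Eb_add, Eb_add, Eb_smul, Eb_smul, Eb_smul, Eb_one, Eb_two, Eb_four, ← hv, ← hsv]
  have hq : 0 ≤ p * (1 - p) := mul_nonneg h0 (by linarith)
  have : 1 / (4 * s) * 0 + 1 / (4 * s ^ 2) * s ^ 2 +
      -(1 / (24 * s ^ 4)) * (3 * (s ^ 2) ^ 2 + s ^ 2 * (1 - 6 * (p * (1 - p))))
      = 1 / 4 - 3 / 24 - (1 - 6 * (p * (1 - p))) / (24 * s ^ 2) := by
    field_simp; ring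
  rw [this, hsv]
  have : (1 - 6 * (p * (1 - p))) / (24 * v) ≤ 2 / 24 := by
    rw [div_le_div_iff₀ (by positivity) (by norm_num)]
    nlinarith
  linarith

/-- Binomial point mass. -/
noncomputable def bb (m k : ℕ) (p : ℝ) : ℝ := Eb p m (fun i => if i = k then 1 else 0)

lemma bb_eq (m : ℕ) : ∀ (k : ℕ) (p : ℝ), bb m k p = m.choose k * p ^ k * (1 - p) ^ (m - k) := by
  induction m with
  | zero =>
    intro k p
    rcases k with _ | k <;> simp [bb, Eb]
  | succ m ih =>
    intro k p
    rcases k with _ | k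
    · have := ih 0 p
      simp only [bb] at this
      simp only [bb, Eb]
      rw [this]
      simp [Eb_const]; ring
    · have h1 := ih k p
      have h2 := ih (k + 1) p
      simp only [bb] at h1 h2
      simp only [bb, Eb, add_left_inj]
      rw [h1, h2, Nat.choose_succ_succ]
      rcases lt_or_ge k m with h | h
      · have e1 : m - k = (m - (k + 1)) + 1 := by omega
        have e2 : m + 1 - (k + 1) = (m - (k + 1)) + 1 := by omega
        rw [e2, e1]; push_cast; ring
      · rw [Nat.choose_eq_zero_of_lt (show m < k + 1 by omega)]
        have e2 : m + 1 - (k + 1) = m - k := by omega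
        rw [e2]; push_cast; ring

lemma Fb_deriv (m : ℕ) : ∀ (k : ℕ) (p : ℝ), HasDerivAt (Fb (m + 1) k) ((m + 1) * bb m k p) p := by
  induction m with
  | zero =>
    intro k p
    rcases k with _ | k
    · have : Fb (0 + 1) 0 = fun p => p := by funext q; simp [Fb, Eb]
      rw [this]; simpa [bb, Eb] using hasDerivAt_id' p
    · have : Fb (0 + 1) (k + 1) = fun p => 0 := by funext q; simp [Fb, Eb]
      rw [this]; simpa [bb, Eb] using hasDerivAt_const p (0 : ℝ)
  | succ m ih =>
    intro k p
    rcases k with _ | k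
    · have : Fb (m + 1 + 1) 0 = fun p => p * 1 + (1 - p) * Fb (m + 1) 0 p := by
        funext q; rw [Fb, Eb]; simp [Fb, Eb_const]
      rw [this]
      have h := ((hasDerivAt_id p).mul_const (1 : ℝ)).add
        (((hasDerivAt_id p).const_sub 1).mul (ih 0 p))
      refine h.congr_deriv ?_
      have h2 : Fb (m + 1) 0 p = 1 - bb (m + 1) 0 p := by
        rw [Fb, bb, eq_sub_iff_add_eq, ← Eb_add]
        refine Eq.trans ?_ (Eb_const p (m + 1) 1)
        congr 1; funext i; rcases i with _ | i <;> simp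
      rw [h2, bb_eq, bb_eq]; simp; ring
    · have : Fb (m + 1 + 1) (k + 1) =
          fun p => p * Fb (m + 1) k p + (1 - p) * Fb (m + 1) (k + 1) p := by
        funext q; rw [Fb, Eb]; simp [Fb]
      rw [this]
      have h := ((hasDerivAt_id p).mul (ih k p)).add
        (((hasDerivAt_id p).const_sub 1).mul (ih (k + 1) p))
      refine h.congr_deriv ?_
      have h2 : Fb (m + 1) k p = Fb (m + 1) (k + 1) p + bb (m + 1) (k + 1) p := by
        rw [Fb, Fb, bb, ← Eb_add]
        congr 1; funext i
        split_ifs <;> first | omega | norm_num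
      have h3 : bb (m + 1) (k + 1) p = p * bb m k p + (1 - p) * bb m (k + 1) p := by
        simp [bb, Eb]
      simp only [id]
      rw [h2]
      push_cast
      linear_combination ((m : ℝ) + 1) * (-h3)

lemma bb_mono (m k : ℕ) (hk : k ≤ m) (hm : 0 < m) :
    MonotoneOn (bb m k) (Set.Icc 0 ((k : ℝ) / m)) := by
  have hm' : (0 : ℝ) < m := by exact_mod_cast hm
  obtain ⟨j, rfl⟩ := Nat.exists_eq_add_of_le hk
  have e : bb (k + j) k = fun p => ((k + j).choose k : ℝ) * (p ^ k * (1 - p) ^ j) := by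
    funext p; rw [bb_eq]; simp [mul_assoc]
  rw [e]
  have hd : ∀ p : ℝ, HasDerivAt (fun p : ℝ => ((k + j).choose k : ℝ) * (p ^ k * (1 - p) ^ j))
      (((k + j).choose k : ℝ) * ((k * p ^ (k - 1) * 1) * (1 - p) ^ j
        + p ^ k * (j * (1 - p) ^ (j - 1) * (-1)))) p := by
    intro p
    exact (((hasDerivAt_id p).pow k).mul (((hasDerivAt_id p).const_sub 1).pow j)).const_mul _
  apply monotoneOn_of_deriv_nonneg (convex_Icc _ _)
  · exact fun p _ => (hd p).continuousAt.continuousWithinAt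
  · exact fun p _ => (hd p).differentiableAt.differentiableWithinAt
  · intro p hp
    rw [interior_Icc] at hp
    rw [(hd p).deriv]
    obtain ⟨h0, h1⟩ := hp
    have h1' := h1
    rw [lt_div_iff₀ hm'] at h1
    push_cast at h1
    have hp1 : p < 1 := by
      refine h1'.trans_le ?_
      rw [div_le_one hm']; exact_mod_cast hk
    apply mul_nonneg (by positivity)
    rcases k with _ | k
    · exfalso; simp at h1'; linarith
    rcases j with _ | j
    · simp; positivity
    have : 0 ≤ p ^ k * (1 - p) ^ j * (((k + 1 : ℕ) : ℝ) * (1 - p) - ((j + 1 : ℕ) : ℝ) * p) := by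
      have : (0 : ℝ) < 1 - p := by linarith
      apply mul_nonneg (by positivity)
      push_cast at h1 ⊢
      nlinarith
    simp only [Nat.add_sub_cancel]
    calc _ ≤ _ := this
      _ = _ := by ring

lemma Fb_convex (m k : ℕ) (hk : 1 ≤ k) (hkm : k < m) :
    ConvexOn ℝ (Set.Icc 0 ((k : ℝ) / m)) (Fb m k) := by
  obtain ⟨m, rfl⟩ : ∃ M, m = M + 1 := ⟨m - 1, by omega⟩
  apply MonotoneOn.convexOn_of_deriv (convex_Icc _ _)
  · exact fun p _ => (Fb_deriv m k p).continuousAt.continuousWithinAt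
  · exact fun p _ => (Fb_deriv m k p).differentiableAt.differentiableWithinAt
  · intro x hx y hy hxy
    rw [(Fb_deriv m k x).deriv, (Fb_deriv m k y).deriv]
    rw [interior_Icc] at hx hy
    have hm : (0 : ℝ) < m := by exact_mod_cast (by omega : 0 < m)
    have hle : (k : ℝ) / (m + 1 : ℕ) ≤ k / m := by
      gcongr; omega
    have := bb_mono m k (by omega) (by omega) ⟨hx.1.le, hx.2.le.trans hle⟩
      ⟨hy.1.le, hy.2.le.trans hle⟩ hxy
    gcongr

lemma Fb_mono (m k : ℕ) (hkm : k < m) : MonotoneOn (Fb m k) (Set.Icc 0 1) := by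
  obtain ⟨m, rfl⟩ : ∃ M, m = M + 1 := ⟨m - 1, by omega⟩
  apply monotoneOn_of_deriv_nonneg (convex_Icc _ _)
  · exact fun p _ => (Fb_deriv m k p).continuousAt.continuousWithinAt
  · exact fun p _ => (Fb_deriv m k p).differentiableAt.differentiableWithinAt
  · intro x hx
    rw [interior_Icc] at hx
    rw [(Fb_deriv m k x).deriv, bb_eq]
    have : 0 ≤ x := hx.1.le
    have : 0 ≤ 1 - x := by linarith [hx.2]
    positivity

/-- Secant comparison. -/
lemma Fb_secant (m k : ℕ) (hk : 1 ≤ k) (hkm : k < m) (a b : ℝ) (ha : 0 ≤ a) (hab : a ≤ b)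
    (hb : b < (k : ℝ) / m) :
    (k / m - b) * (Fb m k (k / m) - Fb m k a) ≤
      (k / m - a) * (Fb m k (k / m) - Fb m k b) := by
  rcases hab.eq_or_lt with rfl | hab
  · exact le_rfl
  have hc := (Fb_convex m k hk hkm).secant_mono_aux2 (x := a) (y := b) (z := (k : ℝ) / m)
    ⟨ha, (hab.trans hb).le⟩ ⟨(ha.trans (hab.trans hb).le), le_rfl⟩ hab hb
  have hc3 := (Fb_convex m k hk hkm).secant_mono_aux3 (x := a) (y := b) (z := (k : ℝ) / m)
    ⟨ha, (hab.trans hb).le⟩ ⟨(ha.trans (hab.trans hb).le), le_rfl⟩ hab hb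
  rw [div_le_div_iff₀ (by linarith) (by linarith)] at hc3
  linarith

set_option maxHeartbeats 2000000 in
lemma numeric (m k : ℕ) (hk : 1 ≤ k) (hkm : k < m) (δ p₁ p₂ : ℝ) (hδ : 0 < δ) (hδ3 : δ < 1 / 3)
    (h1 : (m : ℝ) * p₁ = k / (1 + δ)) (h2 : (m : ℝ) * p₂ = k / (1 - δ)) (hp2 : p₂ ≤ 1) :
    1 - Real.exp (- (δ ^ 2 * k / 1000)) ≤ Fb m k p₂ - Fb m k p₁ := by
  have hm : (0 : ℝ) < m := by exact_mod_cast (by omega : 0 < m)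
  have hk' : (1 : ℝ) ≤ k := by exact_mod_cast hk
  have hd1 : 0 < 1 - δ := by linarith
  set p₀ : ℝ := (k : ℝ) / m with hp0
  have e1 : p₁ = p₀ / (1 + δ) := by
    rw [hp0]; field_simp; field_simp at h1; linarith
  have e2 : p₂ = p₀ / (1 - δ) := by
    rw [hp0]; field_simp; field_simp at h2; linarith
  have hp0p : 0 < p₀ := by positivity
  have h10 : p₁ < p₀ := by rw [e1]; apply div_lt_self hp0p; linarith
  have h02 : p₀ ≤ p₂ := by rw [e2, le_div_iff₀ hd1]; nlinarith
  have h1p : 0 < p₁ := by rw [e1]; positivity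
  by_cases hx : 6 ≤ δ ^ 2 * k
  · have a := chern_up h1p.le (by linarith) hδ m k h1
    have b := chern_low (by linarith) hp2 hδ (by linarith) m k h2
    have a' : Fb m k p₁ ≤ Real.exp (- (δ ^ 2 * k / 4)) := by
      refine a.trans (Real.exp_le_exp.mpr (neg_le_neg ?_))
      have : δ ^ 2 / 4 ≤ δ ^ 2 / ((2 + δ) * (1 + δ)) := by gcongr; nlinarith
      calc _ = (k : ℝ) * (δ ^ 2 / 4) := by ring
        _ ≤ _ := by gcongr
    have b' : 1 - Fb m k p₂ ≤ Real.exp (- (δ ^ 2 * k / 4)) := by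
      refine b.trans (Real.exp_le_exp.mpr (neg_le_neg ?_))
      nlinarith
    have c : 2 * Real.exp (- (δ ^ 2 * k / 4)) ≤ Real.exp (- (δ ^ 2 * k / 1000)) := by
      have : - (δ ^ 2 * k / 1000) = - (δ ^ 2 * k / 4) + (δ ^ 2 * k) * (249 / 1000) := by ring
      rw [this, Real.exp_add, mul_comm]
      gcongr
      have := Real.add_one_le_exp ((δ ^ 2 * k) * (249 / 1000))
      linarith
    linarith
  · push Not at hx
    have hE := Real.add_one_le_exp (- (δ ^ 2 * k / 1000))
    have hmono : Fb m k p₀ ≤ Fb m k p₂ :=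
      Fb_mono m k hkm ⟨hp0p.le, by linarith⟩ ⟨by linarith, hp2⟩ h02
    have hmid := Fb_mid m k hk hkm
    rw [← hp0] at hmid
    suffices h : δ ^ 2 * k / 1000 ≤ Fb m k p₀ - Fb m k p₁ by linarith
    have d01 : p₀ - p₁ = p₀ * (δ / (1 + δ)) := by rw [e1]; field_simp; ring
    by_cases hk25 : (k : ℝ) < 25
    · have s := Fb_secant m k hk hkm 0 p₁ le_rfl h1p.le h10
      rw [← hp0, Fb_zero, d01, sub_zero, sub_zero, mul_assoc] at s
      have s := le_of_mul_le_mul_left s hp0p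
      refine le_trans ?_ s
      have : δ * (3 / 4) ≤ δ / (1 + δ) := by
        rw [le_div_iff₀ (by linarith)]; nlinarith
      calc δ ^ 2 * k / 1000 ≤ (δ * (3 / 4)) * (1 / 24) := by nlinarith [mul_pos hδ hδ]
        _ ≤ _ := by gcongr
    · push Not at hk25
      obtain ⟨r, hr, hrk⟩ : ∃ r : ℝ, 0 ≤ r ∧ r ^ 2 = k :=
        ⟨√k, Real.sqrt_nonneg _, Real.sq_sqrt (by linarith)⟩
      have hr5 : 5 ≤ r := by nlinarith
      have hdr : δ * r ≤ 5 / 2 := by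
        have : (δ * r) ^ 2 < 6 := by rw [mul_pow, hrk]; exact hx
        nlinarith
      set θ : ℝ := 5 / r with hθ
      have hrp : 0 < r := by linarith
      have hθp : 0 < θ := by positivity
      have hθ1 : θ ≤ 1 := by rw [hθ, div_le_one hrp]; exact hr5
      have hδθ : δ ≤ θ := by rw [hθ, le_div_iff₀ hrp]; linarith
      set a : ℝ := p₀ / (1 + θ) with ha
      have hap : 0 ≤ a := by positivity
      have ha1 : a ≤ p₁ := by rw [ha, e1]; gcongr
      have ca := chern_up hap (by linarith) hθp m k (by rw [ha, hp0]; field_simp)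
      have ca' : Fb m k a ≤ 1 / 60 := by
        refine ca.trans ?_
        have : 25 / 6 ≤ k * (θ ^ 2 / ((2 + θ) * (1 + θ))) := by
          have : k * (θ ^ 2 / ((2 + θ) * (1 + θ))) = 25 / ((2 + θ) * (1 + θ)) := by
            rw [← hrk, hθ]; field_simp; norm_num
          rw [this]
          gcongr; nlinarith
        calc _ ≤ Real.exp (- (25 / 6)) := Real.exp_le_exp.mpr (neg_le_neg this)
          _ ≤ 1 / 60 := by
            rw [Real.exp_neg, ← one_div]
            apply one_div_le_one_div_of_le (by norm_num)
            have h1 := Real.exp_one_gt_d9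
            have : Real.exp (25 / 6) = Real.exp 1 ^ 4 * Real.exp (1 / 6) := by
              rw [← Real.exp_nat_mul, ← Real.exp_add]; norm_num
            rw [this]
            have h2 := Real.add_one_le_exp (1 / 6 : ℝ)
            have h3 : (2.71 : ℝ) ^ 4 ≤ Real.exp 1 ^ 4 := by gcongr; linarith
            nlinarith
      have s := Fb_secant m k hk hkm a p₁ hap ha1 h10
      have d0a : p₀ - a = p₀ * (θ / (1 + θ)) := by rw [ha]; field_simp; ring
      rw [← hp0, d01, d0a, mul_assoc, mul_assoc] at s
      have s := le_of_mul_le_mul_left s hp0p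
      set D := Fb m k p₀ - Fb m k p₁ with hD
      have t1 : δ / (1 + δ) * (1 / 40) ≤ θ / (1 + θ) * D := by
        refine le_trans ?_ s
        gcongr; linarith
      have t2 : δ / (1 + θ) * (1 / 40) ≤ θ / (1 + θ) * D := by
        refine le_trans ?_ t1
        gcongr
      have t3 : δ * (1 / 40) ≤ θ * D := by
        have : 0 < 1 + θ := by linarith
        have h := mul_le_mul_of_nonneg_left t2 this.le
        field_simp at h ⊢
        linarith
      have t4 : r * δ * (1 / 40) ≤ 5 * D := by
        have h := mul_le_mul_of_nonneg_left t3 hrp.le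
        have e : r * (θ * D) = 5 * D := by rw [hθ]; field_simp
        rw [e] at h; linarith
      have : δ ^ 2 * k = (δ * r) * (δ * r) := by rw [← hrk]; ring
      rw [this]
      have : 0 ≤ δ * r := by positivity
      nlinarith

open Classical in
/-- Number of samples in `A`. -/
noncomputable def cnt {α : Type*} (A : Set α) {m : ℕ} (X : Fin m → α) : ℕ :=
  ∑ j, if X j ∈ A then 1 else 0

lemma cnt_eq {α : Type*} (A : Set α) {m : ℕ} (X : Fin m → α) :
    cnt A X = ({j : Fin m | X j ∈ A}).ncard := by
  classical
  rw [cnt, Finset.sum_boole, Set.ncard_eq_toFinset_card']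
  simp

lemma cnt_meas {α : Type*} [MeasurableSpace α] {A : Set α} (hA : MeasurableSet A) (m : ℕ) :
    Measurable (cnt A : (Fin m → α) → ℕ) := by
  classical
  unfold cnt
  refine Finset.measurable_sum _ (fun j _ => ?_)
  exact Measurable.ite (measurable_pi_apply j hA) measurable_const measurable_const

open Classical in
lemma pi_cnt {α : Type*} [MeasurableSpace α] (μ : Measure α) [IsProbabilityMeasure μ] {A : Set α}
    (hA : MeasurableSet A) (m : ℕ) : ∀ S : Set ℕ,
    (Measure.pi (fun _ : Fin m => μ)).real {X | cnt A X ∈ S} =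
      Eb (μ.real A) m (fun i => if i ∈ S then 1 else 0) := by
  induction m with
  | zero =>
    intro S
    simp only [Eb, cnt, Finset.univ_eq_empty, Finset.sum_empty]
    by_cases h : 0 ∈ S <;> simp [h]
  | succ m ih =>
    intro S
    have mp := measurePreserving_piFinSuccAbove (fun _ : Fin (m + 1) => μ) 0
    set T : Set (α × (Fin m → α)) :=
      {z | (if z.1 ∈ A then 1 else 0) + cnt A z.2 ∈ S} with hT
    have hTm : MeasurableSet T := by
      have : Measurable (fun z : α × (Fin m → α) => (if z.1 ∈ A then 1 else 0) + cnt A z.2) :=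
        (Measurable.ite (measurable_fst hA) measurable_const measurable_const).add
          ((cnt_meas hA m).comp measurable_snd)
      exact this (MeasurableSet.of_discrete)
    have e : {X : Fin (m + 1) → α | cnt A X ∈ S} =
        (MeasurableEquiv.piFinSuccAbove (fun _ => α) 0) ⁻¹' T := by
      ext X
      have : cnt A X = (if X 0 ∈ A then 1 else 0) + cnt A (fun j : Fin m => X j.succ) := by
        rw [cnt, cnt, Fin.sum_univ_succ]
      change cnt A X ∈ S ↔ (if X 0 ∈ A then 1 else 0) + cnt A (fun j : Fin m => X j.succ) ∈ S
      rw [this]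
    have h1 := ih S
    have h2 := ih {i | i + 1 ∈ S}
    set ν := Measure.pi (fun _ : Fin m => μ) with hν
    have val : Measure.pi (fun _ : Fin (m + 1) => μ) {X | cnt A X ∈ S} =
        ν {X | cnt A X ∈ {i | i + 1 ∈ S}} * μ A + ν {X | cnt A X ∈ S} * μ Aᶜ := by
      rw [e, mp.measure_preimage hTm.nullMeasurableSet, Measure.prod_apply hTm,
        ← lintegral_add_compl _ hA]
      congr 1
      · rw [← setLIntegral_const]
        apply setLIntegral_congr_fun hA
        intro x hx
        simp only [hT]
        congr 1
        ext y; simp [hx, add_comm]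
      · rw [← setLIntegral_const]
        apply setLIntegral_congr_fun hA.compl
        intro x hx
        simp only [hT]
        congr 1
        ext y
        have : x ∉ A := hx
        simp [this]
    rw [Measure.real, val, ENNReal.toReal_add (by finiteness) (by finiteness), ENNReal.toReal_mul,
      ENNReal.toReal_mul]
    simp only [← Measure.real_def]
    rw [h1, h2, probReal_compl_eq_one_sub hA]
    simp only [Eb, Set.mem_setOf_eq]
    ring

lemma unif_real {α : Type*} [MeasurableSpace α] (P : Finset α) (hne : P.Nonempty) {A : Set α}
    (hA : MeasurableSet A) (t : ℕ) (h : ({p | p ∈ P ∧ p ∈ A}).ncard = t) :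
    (PMF.uniformOfFinset P hne).toMeasure.real A = t / P.card := by
  classical
  rw [Measure.real, PMF.toMeasure_uniformOfFinset_apply hne A hA, ENNReal.toReal_div]
  simp only [ENNReal.toReal_natCast]
  rw [← h, ← Set.ncard_coe_finset]
  congr 3
  ext; simp

lemma top_set {α : Type*} (P : Finset α) (f : α → ℝ) : ∀ t ≤ P.card,
    ∃ A ⊆ P, A.card = t ∧ ∀ p ∈ A, ∀ q ∈ P, q ∉ A → f q ≤ f p := by
  classical
  intro t
  induction t with
  | zero => intro _; exact ⟨∅, by simp, by simp, by simp⟩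
  | succ t ih =>
    intro h
    obtain ⟨A, hAP, hc, hA⟩ := ih (by omega)
    have hn : (P \ A).Nonempty := by
      rw [← Finset.card_pos, Finset.card_sdiff_of_subset hAP]; omega
    obtain ⟨x, hx, hmax⟩ := Finset.exists_max_image (P \ A) f hn
    rw [Finset.mem_sdiff] at hx
    refine ⟨insert x A, Finset.insert_subset hx.1 hAP, ?_, ?_⟩
    · rw [Finset.card_insert_of_notMem hx.2, hc]
    · intro p hp q hq hqA
      rw [Finset.mem_insert, not_or] at hqA
      rcases Finset.mem_insert.mp hp with rfl | hp
      · exact hmax q (Finset.mem_sdiff.mpr ⟨hq, hqA.2⟩)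
      · exact hA p hp q hq hqA.2

/-- Sandwich Lemma for MEB with outliers: the sample-based estimate `l̃` of the
`(t+1)`-th largest distance `l` satisfies `l̃ ≤ l` and the ball of radius `l̃`
excludes at most `((1+δ)²/(1-δ))·γ·n` points, with probability at least `1-η`. -/
theorem sandwich_lemma :
    ∃ c : ℝ, 0 < c ∧
      ∀ (d n : ℕ) (P : Finset (EuclideanSpace ℝ (Fin d))) (hne : P.Nonempty),
        P.card = n →
        ∀ γ δ η : ℝ, γ ∈ Set.Ioo (0 : ℝ) 1 → δ ∈ Set.Ioo (0 : ℝ) (1 / 3) →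
          η ∈ Set.Ioo (0 : ℝ) 1 →
        ∀ o : EuclideanSpace ℝ (Fin d),
          (∀ p ∈ P, ∀ q ∈ P, p ≠ q → dist p o ≠ dist q o) →
        ∀ t : ℕ, (t : ℝ) = (1 + δ) * γ * n → t < n →
        ∀ t₂ : ℕ, (t₂ : ℝ) = ((1 + δ) ^ 2 / (1 - δ)) * γ * n → t₂ ≤ n →
        ∀ l : ℝ, (∃ p ∈ P, dist p o = l) →
          ({p : EuclideanSpace ℝ (Fin d) | p ∈ P ∧ l < dist p o}).ncard = t →
        ∀ m : ℕ, c * (1 / (δ ^ 2 * γ)) * Real.log (1 / η) ≤ (m : ℝ) →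
        ∀ k : ℕ, (k : ℝ) = (1 + δ) ^ 2 * γ * m → k < m →
        ∀ ltil : (Fin m → EuclideanSpace ℝ (Fin d)) → ℝ,
          (∀ X : Fin m → EuclideanSpace ℝ (Fin d),
            (∃ j : Fin m, dist (X j) o = ltil X) ∧
            ({j : Fin m | ltil X < dist (X j) o}).ncard ≤ k ∧
            k + 1 ≤ ({j : Fin m | ltil X ≤ dist (X j) o}).ncard) →
        ENNReal.ofReal (1 - η) ≤
          Measure.pi (fun _ : Fin m => (PMF.uniformOfFinset P hne).toMeasure)
            {X : Fin m → EuclideanSpace ℝ (Fin d) |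
              ltil X ≤ l ∧
              (({p : EuclideanSpace ℝ (Fin d) | p ∈ P ∧ ltil X < dist p o}).ncard : ℝ) ≤
                ((1 + δ) ^ 2 / (1 - δ)) * γ * n} := by
  refine ⟨1000, by norm_num, ?_⟩
  intro d n P hne hn γ δ η hγ hδ hη o _ t ht htn t₂ ht₂ ht₂n l _ hl m hm k hk hkm ltil hlt
  obtain ⟨hγ0, hγ1⟩ := hγ
  obtain ⟨hδ0, hδ3⟩ := hδ
  obtain ⟨hη0, hη1⟩ := hη
  have hmp : (0 : ℝ) < m := by exact_mod_cast (by omega : 0 < m)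
  have hnp : (0 : ℝ) < n := by exact_mod_cast (by omega : 0 < n)
  have hk1 : 1 ≤ k := by
    have : (0 : ℝ) < k := by rw [hk]; positivity
    exact_mod_cast this
  have hd1 : 0 < 1 - δ := by linarith
  set μ := (PMF.uniformOfFinset P hne).toMeasure with hμ
  have : IsProbabilityMeasure μ := PMF.toMeasure.isProbabilityMeasure _
  set A₁ : Set (EuclideanSpace ℝ (Fin d)) := {x | l < dist x o} with hA₁
  have hA₁m : MeasurableSet A₁ :=
    measurableSet_lt measurable_const (measurable_id.dist measurable_const)
  obtain ⟨A₂, hA₂P, hA₂c, hA₂⟩ := top_set P (fun p => dist p o) t₂ (by omega)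
  have hA₂m : MeasurableSet (A₂ : Set (EuclideanSpace ℝ (Fin d))) := A₂.measurableSet
  have hp1 : μ.real A₁ = t / n := by rw [← hn]; exact unif_real P hne hA₁m t hl
  have hp2 : μ.real (A₂ : Set (EuclideanSpace ℝ (Fin d))) = t₂ / n := by
    rw [← hn]
    refine unif_real P hne hA₂m t₂ ?_
    rw [← hA₂c, ← Set.ncard_coe_finset]
    congr 1; ext x
    simp only [Set.mem_setOf_eq, Finset.mem_coe]
    exact ⟨fun h => h.2, fun h => ⟨hA₂P h, h⟩⟩
  have num := numeric m k hk1 hkm δ (t / n) (t₂ / n) hδ0 hδ3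
    (by rw [ht, hk]; field_simp) (by rw [ht₂, hk]; field_simp)
    (by rw [div_le_one hnp]; exact_mod_cast ht₂n)
  set ν := Measure.pi (fun _ : Fin m => μ) with hν
  have m1 : ν.real {X | cnt A₁ X ∈ Set.Ioi k} = Fb m k (t / n) := by
    rw [hν, pi_cnt μ hA₁m, hp1]; simp [Fb]
  have m2 : ν.real {X | cnt (A₂ : Set (EuclideanSpace ℝ (Fin d))) X ∈ Set.Ioi k}
      = Fb m k (t₂ / n) := by
    rw [hν, pi_cnt μ hA₂m, hp2]; simp [Fb]
  have hηe : Real.exp (- (δ ^ 2 * k / 1000)) ≤ η := by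
    rw [← Real.le_log_iff_exp_le hη0]
    rw [one_div η, Real.log_inv] at hm
    have hm2 : 1000 * (- Real.log η) ≤ m * (δ ^ 2 * γ) := by
      have h := mul_le_mul_of_nonneg_right hm (by positivity : 0 ≤ δ ^ 2 * γ)
      have e : 1000 * (1 / (δ ^ 2 * γ)) * -Real.log η * (δ ^ 2 * γ) = 1000 * (- Real.log η) := by
        field_simp
      rwa [e] at h
    have : (m : ℝ) * (δ ^ 2 * γ) ≤ δ ^ 2 * k := by
      rw [hk]
      have : 0 < δ ^ 2 * γ * m := by positivity
      nlinarith
    linarith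
  set G : Set (Fin m → EuclideanSpace ℝ (Fin d)) := {X | ltil X ≤ l ∧
              (({p : EuclideanSpace ℝ (Fin d) | p ∈ P ∧ ltil X < dist p o}).ncard : ℝ) ≤
                ((1 + δ) ^ 2 / (1 - δ)) * γ * n} with hG
  have sub : {X | cnt (A₂ : Set (EuclideanSpace ℝ (Fin d))) X ∈ Set.Ioi k} ⊆
      G ∪ {X | cnt A₁ X ∈ Set.Ioi k} := by
    intro X hX
    by_cases hX1 : cnt A₁ X ∈ Set.Ioi k
    · exact Or.inr hX1
    left
    obtain ⟨-, hle, hge⟩ := hlt X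
    simp only [Set.mem_setOf_eq, Set.mem_Ioi, not_lt, cnt_eq] at hX hX1
    constructor
    · by_contra! hcon
      have : ({j : Fin m | ltil X ≤ dist (X j) o}).ncard ≤ ({j : Fin m | X j ∈ A₁}).ncard :=
        Set.ncard_le_ncard (fun j hj => hcon.trans_le hj) (Set.toFinite _)
      omega
    · obtain ⟨j, hj, hj2⟩ : ∃ j, X j ∈ A₂ ∧ dist (X j) o ≤ ltil X := by
        by_contra! hcon
        have : ({j : Fin m | X j ∈ (A₂ : Set (EuclideanSpace ℝ (Fin d)))}).ncard ≤
            ({j : Fin m | ltil X < dist (X j) o}).ncard :=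
          Set.ncard_le_ncard (fun j hj => hcon j hj) (Set.toFinite _)
        omega
      rw [← ht₂, ← hA₂c, ← Set.ncard_coe_finset]
      refine Nat.cast_le.mpr (Set.ncard_le_ncard (fun p hp => ?_) A₂.finite_toSet)
      by_contra hpA
      have := hA₂ (X j) hj p hp.1 hpA
      have := hp.2
      linarith
  have hreal : Fb m k (t₂ / n) ≤ ν.real G + Fb m k (t / n) := by
    rw [← m1, ← m2]
    exact (measureReal_mono sub).trans (measureReal_union_le _ _)
  apply ENNReal.ofReal_le_of_le_toReal
  change 1 - η ≤ ν.real G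
  linarith
end

section
/- There is an absolute constant c > 0 with the following property (Generalized Uniform-Adaptive Sampling). Let P be a set of n distinct points, let γ, δ, η ∈ (0,1), let P_opt ⊆ P with |P_opt| = (1−γ)n, and let f : P → ℝ be injective. Assume t := (1+δ)γn is an integer with t ≤ n, and let Q be the set of the t points of P with the largest f-values. Let m be an integer with m ≥ c·(1/(δγ))·log(1/η) such that t' := (3/2)(1+δ)γm is an integer with t' ≤ m. Let X_1, …, X_m be independent random variables, each uniformly distributed on P, and let Q' ⊆ {1,…,m} be any set of t' sample indices whose sampled points have the t' largest values among f(X_1), …, f(X_m) (ties between indices that sample the same point of P may be broken arbitrarily). Then, with probability at least 1−η, the number of indices j ∈ Q' with X_j ∈ P_opt ∩ Q is at least (δ/(3(1+δ)))·t'. -/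
open MeasureTheory

set_option linter.unusedSectionVars false

namespace GUAS

/-- average over all samples -/
noncomputable def EE {β : Type} [Fintype β] (m : ℕ) (F : (Fin m → β) → ℝ) : ℝ :=
  (∑ X, F X) / (Fintype.card β : ℝ) ^ m

/-- indicator -/
def ind {β : Type} [DecidableEq β] (A : Finset β) (x : β) : ℝ := if x ∈ A then 1 else 0

/-- number of samples in `A` -/
def NN {β : Type} [DecidableEq β] {m : ℕ} (A : Finset β) (X : Fin m → β) : ℝ := ∑ i, ind A (X i)

section
variable {β : Type} [Fintype β] [DecidableEq β]

lemma EE_succ (m : ℕ) (F : (Fin (m + 1) → β) → ℝ) :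
    EE (m + 1) F =
      (∑ x : β, EE m (fun X => F (Fin.cons x X))) / (Fintype.card β : ℝ) := by
  unfold EE
  rw [← (Fin.consEquiv (fun _ : Fin (m + 1) => β)).sum_comp, Fintype.sum_prod_type,
    ← Finset.sum_div, div_div, pow_succ]
  rfl

lemma EE_add (m : ℕ) (F G : (Fin m → β) → ℝ) :
    EE m (fun X => F X + G X) = EE m F + EE m G := by
  simp [EE, Finset.sum_add_distrib, add_div]

lemma EE_smul (m : ℕ) (c : ℝ) (F : (Fin m → β) → ℝ) :
    EE m (fun X => c * F X) = c * EE m F := by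
  simp [EE, ← Finset.mul_sum, mul_div_assoc]

lemma EE_mono (m : ℕ) (F G : (Fin m → β) → ℝ) (h : ∀ X, F X ≤ G X) : EE m F ≤ EE m G := by
  unfold EE
  gcongr
  exact h _

lemma EE_const [Nonempty β] (m : ℕ) (c : ℝ) : EE m (fun _ : Fin m → β => c) = c := by
  have : (Fintype.card β : ℝ) ≠ 0 := by simp
  unfold EE
  simp only [Finset.sum_const, Finset.card_univ, Fintype.card_fun, Fintype.card_fin, nsmul_eq_mul]
  push_cast
  field_simp

lemma NN_cons {m : ℕ} (A : Finset β) (x : β) (X : Fin m → β) :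
    NN A (Fin.cons x X : Fin (m + 1) → β) = ind A x + NN A X := by
  simp [NN, Fin.sum_univ_succ]

lemma sum_ind (A : Finset β) : ∑ x, ind A x = A.card := by
  simp [ind]

lemma EE_NN [Nonempty β] (m : ℕ) (A : Finset β) :
    EE m (fun X => NN A X) = m * (A.card / Fintype.card β : ℝ) := by
  have hn : (Fintype.card β : ℝ) ≠ 0 := by simp
  induction m with
  | zero => simp [EE, NN]
  | succ m ih =>
    rw [EE_succ]
    simp only [NN_cons, EE_add, EE_const, ih, Finset.sum_add_distrib, sum_ind, Finset.sum_const,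
      Finset.card_univ, nsmul_eq_mul]
    push_cast
    field_simp
    ring

lemma EE_NN_mul [Nonempty β] (m : ℕ) (A B : Finset β) (h : A ⊆ B) :
    EE m (fun X => NN A X * NN B X) = m * (A.card / Fintype.card β : ℝ)
      + (m * m - m) * (A.card / Fintype.card β : ℝ) * (B.card / Fintype.card β : ℝ) := by
  have hn : (Fintype.card β : ℝ) ≠ 0 := by simp
  induction m with
  | zero => simp [EE, NN]
  | succ m ih =>
    have e1 : ∀ x : β, EE m (fun X => (ind A x + NN A X) * (ind B x + NN B X)) =
        ind A x + (ind A x * (m * (B.card / Fintype.card β : ℝ))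
          + (ind B x * (m * (A.card / Fintype.card β : ℝ)) + EE m (fun X => NN A X * NN B X))) := by
      intro x
      rw [← EE_NN m A, ← EE_NN m B, ← EE_smul, ← EE_smul, ← EE_add, ← EE_add]
      rw [show ∀ r : ℝ, ind A x + r = EE m (fun _ : Fin m → β => ind A x) + r from
        fun r => by rw [EE_const], ← EE_add]
      congr 1
      ext X
      have : ind A x * ind B x = ind A x := by
        unfold ind
        by_cases hx : x ∈ A
        · simp [hx, h hx]
        · simp [hx]
      linear_combination this
    rw [EE_succ]
    simp only [NN_cons, e1, Finset.sum_add_distrib, sum_ind, Finset.sum_const,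
      Finset.card_univ, nsmul_eq_mul, ← Finset.sum_mul, ih]
    push_cast
    field_simp
    ring

lemma EE_exp_le [Nonempty β] (m : ℕ) (A : Finset β) (s : ℝ) :
    EE m (fun X => Real.exp (s * NN A X)) ≤
      Real.exp (m * (A.card / Fintype.card β : ℝ) * (Real.exp s - 1)) := by
  have hn : (0 : ℝ) < Fintype.card β := by simp [Fintype.card_pos]
  have key : EE m (fun X => Real.exp (s * NN A X)) =
      (1 + (A.card / Fintype.card β : ℝ) * (Real.exp s - 1)) ^ m := by
    induction m with
    | zero => simp [EE, NN]
    | succ m ih =>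
      rw [EE_succ]
      simp only [NN_cons, mul_add, Real.exp_add, EE_smul, ih, ← Finset.sum_mul]
      have : ∀ x, Real.exp (s * ind A x) = 1 + ind A x * (Real.exp s - 1) := by
        intro x
        unfold ind
        split_ifs <;> simp
      simp only [this, Finset.sum_add_distrib, ← Finset.sum_mul, sum_ind, Finset.sum_const,
        Finset.card_univ, nsmul_eq_mul]
      rw [pow_succ]
      field_simp
  rw [key, mul_assoc, Real.exp_nat_mul]
  apply pow_le_pow_left₀
  · have h1 : (A.card / Fintype.card β : ℝ) ≤ 1 := by
      rw [div_le_one hn]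
      exact_mod_cast Finset.card_le_univ A
    have h0 : 0 ≤ (A.card / Fintype.card β : ℝ) := by positivity
    nlinarith [Real.exp_pos s]
  · linarith [Real.add_one_le_exp ((A.card / Fintype.card β : ℝ) * (Real.exp s - 1))]

lemma NN_eq_card {m : ℕ} (A : Finset β) (X : Fin m → β) :
    NN A X = ((Finset.univ.filter (fun j => X j ∈ A)).card : ℝ) := by
  simp [NN, ind]

set_option maxHeartbeats 2000000 in
open Classical in
lemma core [Nonempty β] (m T : ℕ) (A Q : Finset β) (hAQ : A ⊆ Q) (e μ : ℝ)
    (he : e = m * (A.card / Fintype.card β : ℝ)) (hμ : μ = m * (Q.card / Fintype.card β : ℝ))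
    (h2 : 2 * e ≤ μ) (hT : (T : ℝ) = 3 / 2 * μ) (hT1 : 1 ≤ T) :
    1 - Real.exp (-e / 780) ≤
      EE m (fun X => if e / 2 ≤ NN A X ∧ NN Q X ≤ T then 1 else 0) := by
  have he0 : 0 ≤ e := by rw [he]; positivity
  have hT1' : (1 : ℝ) ≤ T := by exact_mod_cast hT1
  have hμ0 : 2 / 3 ≤ μ := by linarith
  have hint : ∀ X : Fin m → β, ¬ NN Q X ≤ T → (T : ℝ) + 1 ≤ NN Q X := by
    intro X h
    rw [NN_eq_card] at h ⊢
    push Not at h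
    exact_mod_cast h
  have hNpos : ∀ (B : Finset β) (X : Fin m → β), 0 ≤ NN B X := by
    intro B X; rw [NN_eq_card]; positivity
  have hA1 : EE m (fun X => NN A X) = e := by rw [EE_NN, he]
  have hQ1 : EE m (fun X => NN Q X) = μ := by rw [EE_NN, hμ]
  have bd : ∀ B C : Finset β, B ⊆ C → EE m (fun X => NN B X * NN C X) ≤
      m * (B.card / Fintype.card β : ℝ) +
      m * (B.card / Fintype.card β : ℝ) * (m * (C.card / Fintype.card β : ℝ)) := by
    intro B C h
    rw [EE_NN_mul m B C h]
    have : 0 ≤ m * (B.card / Fintype.card β : ℝ) * (C.card / Fintype.card β : ℝ) := by positivity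
    nlinarith
  have hAA := bd A A subset_rfl
  have hAQ' := bd A Q hAQ
  have hQQ := bd Q Q subset_rfl
  simp only [← he, ← hμ] at hAA hAQ' hQQ
  rcases le_or_gt e 2 with hc | hc
  · -- small case
    have hp : EE m (fun X => NN A X + ((-1 / 36) * (NN A X * NN A X)
        + (-1 / (T + 1)) * (NN A X * NN Q X))) ≤
        EE m (fun X => 9 * (if e / 2 ≤ NN A X ∧ NN Q X ≤ T then (1 : ℝ) else 0)) := by
      apply EE_mono
      intro X
      have hq0 := hNpos Q X
      have ha0 := hNpos A X
      have hpr : 0 ≤ NN A X * NN Q X / (T + 1) := by positivity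
      have hr : (-1 / ((T : ℝ) + 1)) * (NN A X * NN Q X) = - (NN A X * NN Q X / (T + 1)) := by
        ring
      rw [hr]
      split_ifs with h
      · nlinarith [sq_nonneg (NN A X - 18)]
      · by_cases hz : NN A X = 0
        · simp [hz]
        · have h1 : 1 ≤ NN A X := by
            rw [NN_eq_card] at hz ⊢
            exact_mod_cast Nat.one_le_iff_ne_zero.mpr (by exact_mod_cast hz)
          have h3 : ¬ NN Q X ≤ T := fun h4 => h ⟨by linarith, h4⟩
          have h5 := hint X h3
          have : NN A X ≤ NN A X * NN Q X / (T + 1) := by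
            rw [le_div_iff₀ (by positivity)]
            exact mul_le_mul_of_nonneg_left h5 ha0
          nlinarith
    rw [EE_add, EE_add, EE_smul, EE_smul, EE_smul, hA1] at hp
    have h7 : (-1 / ((T : ℝ) + 1)) * EE m (fun X => NN A X * NN Q X) ≥ - (5 / 6) * e := by
      have : (-1 / ((T : ℝ) + 1)) * EE m (fun X => NN A X * NN Q X) =
        - (EE m (fun X => NN A X * NN Q X) / (T + 1)) := by ring
      rw [this]
      have : EE m (fun X => NN A X * NN Q X) / (T + 1) ≤ 5 / 6 * e := by
        rw [div_le_iff₀ (by positivity), hT]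
        nlinarith
      linarith
    have h8 := Real.add_one_le_exp (-e / 780)
    nlinarith
  · have split : ∀ X : Fin m → β, (1 : ℝ) - (if e / 2 ≤ NN A X ∧ NN Q X ≤ T then (1 : ℝ) else 0) ≤
        (if NN A X < e / 2 then 1 else 0) + (if (T : ℝ) + 1 ≤ NN Q X then 1 else 0) := by
      intro X
      have := hint X
      split_ifs <;> norm_num
      all_goals exfalso; grind
    have hs := EE_mono m (fun X => 1 + (-1) * (if e / 2 ≤ NN A X ∧ NN Q X ≤ T then (1 : ℝ) else 0))
      (fun X => (if NN A X < e / 2 then 1 else 0) + (if (T : ℝ) + 1 ≤ NN Q X then 1 else 0))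
      (fun X => by have := split X; linarith)
    rw [EE_add, EE_add, EE_smul, EE_const] at hs
    rcases le_or_gt e 20 with hc' | hc'
    · -- Cantelli
      have c1 : EE m (fun X => if NN A X < e / 2 then (1 : ℝ) else 0) ≤ 2 / 3 := by
        have := EE_mono m (fun X => (e / 2 + 2) ^ 2 * (if NN A X < e / 2 then (1 : ℝ) else 0))
          (fun X => NN A X * NN A X + ((-2 * (e + 2)) * NN A X + (e + 2) ^ 2)) (by
            intro X
            split_ifs with h
            · nlinarith
            · nlinarith [sq_nonneg (NN A X - (e + 2))])
        rw [EE_smul, EE_add, EE_add, EE_smul, EE_const, hA1] at this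
        have h9 : (e / 2 + 2) ^ 2 * EE m (fun X => if NN A X < e / 2 then (1 : ℝ) else 0) ≤
          (e / 2 + 2) ^ 2 * (2 / 3) := by nlinarith
        exact le_of_mul_le_mul_left h9 (by positivity)
      have c2 : EE m (fun X => if (T : ℝ) + 1 ≤ NN Q X then (1 : ℝ) else 0) ≤ 4 / 13 := by
        have := EE_mono m (fun X => (μ / 2 + 7 / 3) ^ 2 *
            (if (T : ℝ) + 1 ≤ NN Q X then (1 : ℝ) else 0))
          (fun X => NN Q X * NN Q X + ((-2 * (μ - 4 / 3)) * NN Q X + (μ - 4 / 3) ^ 2)) (by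
            intro X
            split_ifs with h
            · rw [hT] at h; nlinarith
            · nlinarith [sq_nonneg (NN Q X - (μ - 4 / 3))])
        rw [EE_smul, EE_add, EE_add, EE_smul, EE_const, hQ1] at this
        have h9 : (μ / 2 + 7 / 3) ^ 2 * EE m (fun X => if (T : ℝ) + 1 ≤ NN Q X then (1 : ℝ) else 0) ≤
          (μ / 2 + 7 / 3) ^ 2 * (4 / 13) := by nlinarith
        exact le_of_mul_le_mul_left h9 (by positivity)
      have h8 := Real.add_one_le_exp (-e / 780)
      linarith
    · -- Chernoff
      have l1 : Real.log (5 / 4) ≤ 1 / 4 := by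
        have := Real.log_le_sub_one_of_pos (x := 5 / 4) (by norm_num)
        linarith
      have l2 : 1 / 5 ≤ Real.log (5 / 4) := by
        have := Real.one_sub_inv_le_log_of_pos (x := 5 / 4) (by norm_num)
        norm_num at this ⊢
        linarith
      have el : Real.exp (Real.log (5 / 4)) = 5 / 4 := Real.exp_log (by norm_num)
      have el' : Real.exp (-Real.log (5 / 4)) = 4 / 5 := by rw [Real.exp_neg, el]; norm_num
      have c1 : EE m (fun X => if NN A X < e / 2 then (1 : ℝ) else 0) ≤
          Real.exp (- (3 / 40) * e) := by
        have := EE_mono m (fun X => if NN A X < e / 2 then (1 : ℝ) else 0)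
          (fun X => Real.exp (Real.log (5 / 4) * (e / 2)) *
            Real.exp (-Real.log (5 / 4) * NN A X)) (by
            intro X
            split_ifs with h
            · rw [← Real.exp_add, Real.one_le_exp_iff]; nlinarith
            · positivity)
        rw [EE_smul] at this
        refine this.trans ?_
        refine (mul_le_mul_of_nonneg_left (EE_exp_le m A _) (Real.exp_pos _).le).trans ?_
        rw [← Real.exp_add, Real.exp_le_exp, ← he, el']
        nlinarith
      have c2 : EE m (fun X => if (T : ℝ) + 1 ≤ NN Q X then (1 : ℝ) else 0) ≤
          Real.exp (- (3 / 40) * e) := by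
        have := EE_mono m (fun X => if (T : ℝ) + 1 ≤ NN Q X then (1 : ℝ) else 0)
          (fun X => Real.exp (-Real.log (5 / 4) * T) *
            Real.exp (Real.log (5 / 4) * NN Q X)) (by
            intro X
            split_ifs with h
            · rw [← Real.exp_add, Real.one_le_exp_iff]; nlinarith
            · positivity)
        rw [EE_smul] at this
        refine this.trans ?_
        refine (mul_le_mul_of_nonneg_left (EE_exp_le m Q _) (Real.exp_pos _).le).trans ?_
        rw [← Real.exp_add, Real.exp_le_exp, ← hμ, el, hT]
        nlinarith
      have c3 : 2 * Real.exp (- (3 / 40) * e) ≤ Real.exp (-e / 780) := by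
        have : Real.exp (-e / 780) = Real.exp (-e / 780 + (3 / 40) * e) *
          Real.exp (- (3 / 40) * e) := by rw [← Real.exp_add]; ring_nf
        rw [this]
        gcongr
        have := Real.add_one_le_exp (-e / 780 + (3 / 40) * e)
        linarith
      linarith

end

open Classical in
lemma lower {α : Type} [MeasurableSpace α] (P : Finset α) (hne : P.Nonempty) (n m : ℕ)
    [NeZero n] (φ : Fin n ≃ P) (S : Set (Fin m → α)) (G : (Fin m → Fin n) → Prop)
    (hG : ∀ X, G X → (fun i => (φ (X i) : α)) ∈ S) (r : ℝ)
    (hr : r ≤ EE m (fun X => if G X then (1 : ℝ) else 0)) :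
    ENNReal.ofReal r ≤ Measure.pi (fun _ : Fin m => (PMF.uniformOfFinset P hne).toMeasure) S := by
  have hcard : P.card = n := by
    have := Fintype.card_congr φ
    simpa using this.symm
  have hmeas : Measurable (fun x : Fin n => (φ x : α)) := measurable_of_countable _
  have hmap : (PMF.uniformOfFinset P hne).toMeasure =
      Measure.map (fun x : Fin n => (φ x : α)) (PMF.uniformOfFintype (Fin n)).toMeasure := by
    rw [PMF.toMeasure_map _ _ hmeas]
    congr 1
    ext a
    rw [PMF.uniformOfFinset_apply, PMF.map_apply, tsum_fintype]
    simp only [PMF.uniformOfFintype_apply, Fintype.card_fin]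
    split_ifs with h
    · rw [Finset.sum_eq_single (φ.symm ⟨a, h⟩)]
      · simp [hcard]
      · intro b _ hb
        rw [if_neg]
        rintro rfl
        simp at hb
      · simp
    · symm
      apply Finset.sum_eq_zero
      intro x _
      rw [if_neg]
      rintro rfl
      exact h (φ x).2
  simp only [hmap]
  rw [← Measure.pi_map_pi (fun _ => hmeas.aemeasurable)]
  refine le_trans ?_ (Measure.le_map_apply (measurable_of_countable _).aemeasurable _)
  refine le_trans ?_ (measure_mono (s := ((Finset.univ.filter G : Finset (Fin m → Fin n)) :
    Set (Fin m → Fin n))) (fun X hX => hG X (by simpa using hX)))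
  rw [← sum_measure_singleton]
  refine le_trans (ENNReal.ofReal_le_ofReal hr) ?_
  have hn : (0 : ℝ) < n := by exact_mod_cast NeZero.pos n
  unfold EE
  simp only [Measure.pi_singleton, PMF.toMeasure_apply_singleton _ _ (measurableSet_singleton _),
    PMF.uniformOfFintype_apply, Fintype.card_fin, Finset.prod_const, Finset.card_univ,
    Finset.sum_const, nsmul_eq_mul, Finset.sum_boole]
  rw [ENNReal.ofReal_div_of_pos (by positivity), ENNReal.ofReal_natCast,
    ENNReal.ofReal_pow hn.le, ENNReal.ofReal_natCast, div_eq_mul_inv, ENNReal.inv_pow]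

end GUAS

/-- Generalized Uniform-Adaptive Sampling lemma, with an arbitrary injective
ranking function `f` (the distance to a fixed shape center) in place of the
Euclidean distance. -/
theorem generalized_uniform_adaptive_sampling :
    ∃ c : ℝ, 0 < c ∧
      ∀ (α : Type) [MeasurableSpace α] (n : ℕ) (P : Finset α) (hne : P.Nonempty),
        P.card = n →
        ∀ γ δ η : ℝ, γ ∈ Set.Ioo (0 : ℝ) 1 → δ ∈ Set.Ioo (0 : ℝ) 1 →
          η ∈ Set.Ioo (0 : ℝ) 1 →
        ∀ Popt : Finset α, Popt ⊆ P → (Popt.card : ℝ) = (1 - γ) * n →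
        ∀ f : α → ℝ, Set.InjOn f (P : Set α) →
        ∀ t : ℕ, (t : ℝ) = (1 + δ) * γ * n → t ≤ n →
        ∀ Q : Finset α, Q ⊆ P → Q.card = t →
          (∀ p ∈ Q, ∀ q ∈ P, q ∉ Q → f q < f p) →
        ∀ m : ℕ, c * (1 / (δ * γ)) * Real.log (1 / η) ≤ (m : ℝ) →
        ∀ t' : ℕ, (t' : ℝ) = (3 / 2) * (1 + δ) * γ * m → t' ≤ m →
        ∀ Q' : (Fin m → α) → Finset (Fin m),
          (∀ X : Fin m → α,
            (Q' X).card = t' ∧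
            ∀ j ∈ Q' X, ∀ j', j' ∉ Q' X → f (X j') ≤ f (X j)) →
        ENNReal.ofReal (1 - η) ≤
          Measure.pi (fun _ : Fin m => (PMF.uniformOfFinset P hne).toMeasure)
            {X : Fin m → α |
              δ / (3 * (1 + δ)) * (t' : ℝ) ≤
                (({j : Fin m | j ∈ Q' X ∧ X j ∈ Popt ∧ X j ∈ Q}).ncard : ℝ)} := by
  classical
  refine ⟨780, by norm_num, ?_⟩
  intro α _ n P hne hP γ δ η hγ hδ hη Popt hPopt hPoptc f _ t ht _ Q hQP hQc hQ m hm t' ht' _ Q' hQ'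
  obtain ⟨hγ0, hγ1⟩ := hγ
  obtain ⟨hδ0, hδ1⟩ := hδ
  obtain ⟨hη0, hη1⟩ := hη
  have hn0 : 0 < n := hP ▸ hne.card_pos
  have : NeZero n := ⟨hn0.ne'⟩
  have hnR : (0 : ℝ) < n := by exact_mod_cast hn0
  rcases Nat.eq_zero_or_pos m with hm0 | hm0
  · subst hm0
    have : t' = 0 := by
      have : (t' : ℝ) = 0 := by rw [ht']; simp
      exact_mod_cast this
    subst this
    simp only [Nat.cast_zero, mul_zero, Nat.cast_nonneg, Set.ofPred_true, measure_univ]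
    rw [ENNReal.ofReal_le_one]
    linarith
  have hmR : (0 : ℝ) < m := by exact_mod_cast hm0
  have hcP : ((P \ Popt).card : ℝ) = γ * n := by
    rw [Finset.cast_card_sdiff hPopt, hPoptc, hP]; ring
  have hcap : t ≤ (Popt ∩ Q).card + (P \ Popt).card := by
    rw [← hQc]
    refine (Finset.card_le_card ?_).trans (Finset.card_union_le _ _)
    intro x hx
    by_cases h : x ∈ Popt
    · simp [h, hx]
    · simp [h, hQP hx]
  obtain ⟨A, hA, hAc⟩ := Finset.exists_subset_card_eq (s := Popt ∩ Q)
    (n := t - (P \ Popt).card) (by omega)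
  have hle : (P \ Popt).card ≤ t := by
    have : ((P \ Popt).card : ℝ) ≤ t := by rw [hcP, ht]; nlinarith [mul_pos hγ0 hnR]
    exact_mod_cast this
  have hAc' : (A.card : ℝ) = δ * γ * n := by
    rw [hAc, Nat.cast_sub hle, hcP, ht]; ring
  let φ : Fin n ≃ P := (P.equivFinOfCardEq hP).symm
  let pb : Finset α → Finset (Fin n) := fun B => Finset.univ.filter (fun x => (φ x : α) ∈ B)
  have hpb : ∀ B, B ⊆ P → (pb B).card = B.card := by
    intro B hB
    apply Finset.card_bij (fun x _ => (φ x : α))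
    · intro x hx; simpa [pb] using hx
    · intro x _ y _ h; exact φ.injective (Subtype.ext h)
    · intro b hb
      exact ⟨φ.symm ⟨b, hB hb⟩, by simp [pb, hb], by simp⟩
  have hAP : A ⊆ P := fun x hx => hPopt (Finset.mem_inter.1 (hA hx)).1
  have hT1 : 1 ≤ t' := by
    have : (0 : ℝ) < t' := by rw [ht']; positivity
    exact_mod_cast this
  have hcore := GUAS.core m t' (pb A) (pb Q)
    (by
      intro x hx
      have hx' : (φ x : α) ∈ A := by simpa [pb] using hx
      simpa [pb] using (Finset.mem_inter.1 (hA hx')).2)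
    (δ * γ * m) ((1 + δ) * γ * m)
    (by rw [hpb A hAP, hAc', Fintype.card_fin]; field_simp)
    (by rw [hpb Q hQP, hQc, ht, Fintype.card_fin]; field_simp)
    (by nlinarith [mul_pos hγ0 hmR]) (by rw [ht']; ring) hT1
  have hexp : Real.exp (-(δ * γ * m) / 780) ≤ η := by
    rw [← Real.exp_log hη0, Real.exp_le_exp]
    rw [one_div η, Real.log_inv, mul_one_div, div_mul_eq_mul_div, div_le_iff₀ (by positivity)] at hm
    linarith
  refine GUAS.lower P hne n m φ _ (fun X => δ * γ * m / 2 ≤ GUAS.NN (pb A) X ∧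
    GUAS.NN (pb Q) X ≤ t') ?_ _ (((sub_le_sub_left hexp 1).trans hcore).trans
      (le_of_eq (by congr 1; ext X; split_ifs <;> rfl)))
  rintro X ⟨h1, h2⟩
  rw [GUAS.NN_eq_card] at h1 h2
  obtain ⟨hc, hq⟩ := hQ' (fun i => (φ (X i) : α))
  set Y : Fin m → α := fun i => (φ (X i) : α) with hY
  have h2' : (Finset.univ.filter (fun j => X j ∈ pb Q)).card ≤ t' := by exact_mod_cast h2
  have e1 : δ / (3 * (1 + δ)) * (t' : ℝ) = δ * γ * m / 2 := by
    rw [ht']; field_simp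
  change δ / (3 * (1 + δ)) * (t' : ℝ) ≤ _
  rw [e1]
  refine h1.trans ?_
  rw [← Set.ncard_coe_finset]
  apply Nat.cast_le.2
  apply Set.ncard_le_ncard _ (Set.toFinite _)
  intro j hj
  have hjA : Y j ∈ A := by simpa [pb] using hj
  have hj2 := Finset.mem_inter.1 (hA hjA)
  refine ⟨?_, hj2.1, hj2.2⟩
  by_contra hjQ
  have hsub : insert j (Q' Y) ⊆ Finset.univ.filter (fun j => X j ∈ pb Q) := by
    intro i hi
    have : Y i ∈ Q := by
      rcases Finset.mem_insert.1 hi with rfl | hi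
      · exact hj2.2
      · by_contra hnot
        have h3 := hq i hi j hjQ
        have h4 := hQ (Y j) hj2.2 (Y i) (φ (X i)).2 hnot
        linarith
    simpa [pb] using this
  have := Finset.card_le_card hsub
  rw [Finset.card_insert_of_notMem hjQ, hc] at this
  omega
end
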